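/- arXiv:1908.06480 — 3 statements merged into one kernel-verified Lean document; each statement's English description precedes it below -/
import Mathlib

section
/- Let 0 < ε < 1/360, let n ≥ 2/ε², let G be an oriented graph on an n-element vertex set V with t(G) + i(G) ≤ 1/9 + ε⁶, let B be the set of vertices v with d(v) < (2/3 − 5ε²)·n, and suppose |B| ≤ 5ε²·n and V \ B is the disjoint union of three independent sets V₀, V₁, V₂. For i ≠ j let E(V_i,V_j) be the set of edges directed from a vertex of V_i to a vertex of V_j. Then (with indices mod 3) either (A) |E(V₀,V₁)| + |E(V₁,V₂)| + |E(V₂,V₀)| ≤ 12ε·n², and in this case for every i ∈ {0,1,2}: |{u ∈ V_i : d⁺(u,V_{i−1}) < (1/3 − 4ε − 15ε²)·n}| ≤ (15/2)ε·n and |{u ∈ V_i : d⁻(u,V_{i+1}) < (1/3 − 4ε − 15ε²)·n}| ≤ (15/2)ε·n; or (B) |E(V₁,V₀)| + |E(V₂,V₁)| + |E(V₀,V₂)| ≤ 12ε·n², and in this case for every i ∈ {0,1,2}: |{u ∈ V_i : d⁺(u,V_{i+1}) < (1/3 − 4ε − 15ε²)·n}| ≤ (15/2)ε·n and |{u ∈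 V_i : d⁻(u,V_{i−1}) < (1/3 − 4ε − 15ε²)·n}| ≤ (15/2)ε·n. -/
open scoped Classical

/-- An oriented graph: a directed graph with no loops and no pair of
antiparallel edges, given by an asymmetric (hence irreflexive) adjacency
relation. -/
structure OrientedGraph (V : Type) [Fintype V] [DecidableEq V] where
  adj : V → V → Prop
  asymm : ∀ u v : V, adj u v → ¬ adj v u

namespace OrientedGraph

variable {V : Type} [Fintype V] [DecidableEq V]

/-- A 3-element vertex set spans a transitive triangle: its vertices are
pairwise adjacent and the induced orientation is acyclic. -/
def isTransTriangle (G : OrientedGraph V) (s : Finset V) : Prop :=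
  ∃ x y z : V, s = {x, y, z} ∧ G.adj x y ∧ G.adj y z ∧ G.adj x z

/-- A vertex set is independent: no two of its vertices are adjacent. -/
def isIndep (G : OrientedGraph V) (s : Finset V) : Prop :=
  ∀ x ∈ s, ∀ y ∈ s, ¬ G.adj x y

/-- `T₃(G)`: the number of 3-element vertex sets spanning a transitive triangle. -/
noncomputable def T3 (G : OrientedGraph V) : ℕ :=
  ((Finset.univ.powersetCard 3 : Finset (Finset V)).filter G.isTransTriangle).card

/-- `I₃(G)`: the number of 3-element vertex sets that are independent. -/
noncomputable def I3 (G : OrientedGraph V) : ℕ :=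
  ((Finset.univ.powersetCard 3 : Finset (Finset V)).filter G.isIndep).card

/-- `t(G) = T₃(G)/C(n,3)`. -/
noncomputable def tDens (G : OrientedGraph V) : ℝ :=
  (G.T3 : ℝ) / ((Fintype.card V).choose 3 : ℝ)

/-- `i(G) = I₃(G)/C(n,3)`. -/
noncomputable def iDens (G : OrientedGraph V) : ℝ :=
  (G.I3 : ℝ) / ((Fintype.card V).choose 3 : ℝ)

end OrientedGraph

namespace OrientedGraph

variable {V : Type} [Fintype V] [DecidableEq V]

/-- The out-degree of a vertex. -/
noncomputable def outDeg (G : OrientedGraph V) (v : V) : ℕ :=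
  (Finset.univ.filter (fun w => G.adj v w)).card

/-- The in-degree of a vertex. -/
noncomputable def inDeg (G : OrientedGraph V) (v : V) : ℕ :=
  (Finset.univ.filter (fun w => G.adj w v)).card

/-- `d(v) = d⁺(v) + d⁻(v)`, the (total) degree of a vertex. -/
noncomputable def deg (G : OrientedGraph V) (v : V) : ℕ :=
  G.outDeg v + G.inDeg v

/-- `d⁺(u,S)`: the number of out-neighbours of `u` in `S`. -/
noncomputable def outDegIn (G : OrientedGraph V) (u : V) (S : Finset V) : ℕ :=
  (S.filter (fun w => G.adj u w)).card

/-- `d⁻(u,S)`: the number of in-neighbours of `u` in `S`. -/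
noncomputable def inDegIn (G : OrientedGraph V) (u : V) (S : Finset V) : ℕ :=
  (S.filter (fun w => G.adj w u)).card

/-- `|E(A,B)|`: the number of edges directed from a vertex of `A` to a vertex
of `B`. -/
noncomputable def eCount (G : OrientedGraph V) (A B : Finset V) : ℕ :=
  ∑ u ∈ A, G.outDegIn u B

end OrientedGraph

namespace OrientedGraph

variable {W : Type} [Fintype W] [DecidableEq W]

/-- The number of vertices of `S` that are not adjacent to `u`. -/
noncomputable def nonadjIn (G : OrientedGraph W) (u : W) (S : Finset W) : ℕ :=
  (S.filter (fun w => ¬ G.adj u w ∧ ¬ G.adj w u)).card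

theorem outDegIn_add_inDegIn_add_nonadjIn (G : OrientedGraph W) (u : W) (S : Finset W) :
    G.outDegIn u S + G.inDegIn u S + G.nonadjIn u S = S.card := by
  have h₁ := Finset.card_filter_add_card_filter_not (s := S) (fun w => G.adj u w)
  have h₂ := Finset.card_filter_add_card_filter_not
    (s := S.filter (fun w => ¬ G.adj u w)) (fun w => G.adj w u)
  rw [Finset.filter_filter, Finset.filter_filter] at h₂
  have h₃ : S.filter (fun w => ¬ G.adj u w ∧ G.adj w u) = S.filter (fun w => G.adj w u) :=
    Finset.filter_congr fun w _ => ⟨fun h => h.2, fun h => ⟨G.asymm _ _ h, h⟩⟩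
  rw [h₃] at h₂
  unfold outDegIn inDegIn nonadjIn
  omega

theorem outDegIn_mono (G : OrientedGraph W) (u : W) {S T : Finset W} (h : S ⊆ T) :
    G.outDegIn u S ≤ G.outDegIn u T :=
  Finset.card_le_card (Finset.filter_subset_filter _ h)

theorem inDegIn_mono (G : OrientedGraph W) (u : W) {S T : Finset W} (h : S ⊆ T) :
    G.inDegIn u S ≤ G.inDegIn u T :=
  Finset.card_le_card (Finset.filter_subset_filter _ h)

theorem nonadjIn_mono (G : OrientedGraph W) (u : W) {S T : Finset W} (h : S ⊆ T) :
    G.nonadjIn u S ≤ G.nonadjIn u T :=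
  Finset.card_le_card (Finset.filter_subset_filter _ h)

theorem outDegIn_union_le (G : OrientedGraph W) (u : W) (S T : Finset W) :
    G.outDegIn u (S ∪ T) ≤ G.outDegIn u S + G.outDegIn u T := by
  unfold outDegIn
  rw [Finset.filter_union]
  exact Finset.card_union_le _ _

theorem inDegIn_union_le (G : OrientedGraph W) (u : W) (S T : Finset W) :
    G.inDegIn u (S ∪ T) ≤ G.inDegIn u S + G.inDegIn u T := by
  unfold inDegIn
  rw [Finset.filter_union]
  exact Finset.card_union_le _ _

theorem sum_inDegIn_eq_sum_outDegIn (G : OrientedGraph W) (S T : Finset W) :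
    ∑ u ∈ S, G.inDegIn u T = ∑ w ∈ T, G.outDegIn w S :=
  Finset.sum_card_bipartiteAbove_eq_sum_card_bipartiteBelow (fun u w => G.adj w u)

theorem card_mul_card_eq (G : OrientedGraph W) (S T : Finset W) :
    S.card * T.card = ∑ u ∈ S, G.outDegIn u T + ∑ w ∈ T, G.outDegIn w S
      + ∑ u ∈ S, G.nonadjIn u T := by
  rw [← G.sum_inDegIn_eq_sum_outDegIn S T, ← Finset.sum_add_distrib, ← Finset.sum_add_distrib,
    Finset.sum_congr rfl fun u _ => G.outDegIn_add_inDegIn_add_nonadjIn u T,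
    Finset.sum_const, smul_eq_mul]

/-- Pairs of out-neighbours, or of in-neighbours, of a vertex span a transitive triangle unless
they are not adjacent. -/
theorem sum_outDegIn_mul_add_inDegIn_mul_le (G : OrientedGraph W) {S P Q : Finset W}
    (hSP : Disjoint S P) (hSQ : Disjoint S Q) (hPQ : Disjoint P Q) :
    ∑ u ∈ S, (G.outDegIn u P * G.outDegIn u Q + G.inDegIn u P * G.inDegIn u Q)
      ≤ G.T3 + S.card * ∑ w ∈ P, G.nonadjIn w Q := by
  set X : Finset (Σ _ : W, W × W) := S.sigma fun u =>
    (P.filter (fun w => G.adj u w) ×ˢ Q.filter (fun z => G.adj u z)) ∪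
      (P.filter (fun w => G.adj w u) ×ˢ Q.filter (fun z => G.adj z u)) with hX
  have hcard : X.card =
      ∑ u ∈ S, (G.outDegIn u P * G.outDegIn u Q + G.inDegIn u P * G.inDegIn u Q) := by
    rw [hX, Finset.card_sigma]
    refine Finset.sum_congr rfl fun u _ => ?_
    rw [Finset.card_union_of_disjoint, Finset.card_product, Finset.card_product]
    · rfl
    · rw [Finset.disjoint_left]
      rintro ⟨w, z⟩ h₁ h₂
      simp only [Finset.mem_product, Finset.mem_filter] at h₁ h₂
      exact G.asymm _ _ h₁.1.2 h₂.1.2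
  rw [← hcard, ← Finset.card_filter_add_card_filter_not
    (s := X) (fun p => G.adj p.2.1 p.2.2 ∨ G.adj p.2.2 p.2.1)]
  rw [Finset.disjoint_left] at hSP hSQ hPQ
  refine add_le_add ?_ ?_
  · refine Finset.card_le_card_of_injOn (fun p => {p.1, p.2.1, p.2.2}) ?_ ?_
    · rintro ⟨u, w, z⟩ hp
      simp only [hX, Finset.coe_filter, Set.mem_ofPred_eq, Finset.mem_sigma, Finset.mem_union,
        Finset.mem_product, Finset.mem_filter] at hp
      simp only [Finset.coe_filter, Set.mem_ofPred_eq, Finset.mem_powersetCard,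
        Finset.subset_univ, true_and]
      obtain ⟨⟨hu, hwz⟩, hadj⟩ := hp
      have hw : w ∈ P := by tauto
      have hz : z ∈ Q := by tauto
      have huw : u ≠ w := fun h => hSP hu (h ▸ hw)
      have huz : u ≠ z := fun h => hSQ hu (h ▸ hz)
      have hwz' : w ≠ z := fun h => hPQ hw (h ▸ hz)
      refine ⟨Finset.card_eq_three.2 ⟨u, w, z, huw, huz, hwz', rfl⟩, ?_⟩
      rcases hwz with ⟨⟨_, h₁⟩, _, h₂⟩ | ⟨⟨_, h₁⟩, _, h₂⟩ <;> rcases hadj with h₃ | h₃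
      · exact ⟨u, w, z, rfl, h₁, h₃, h₂⟩
      · exact ⟨u, z, w, by ext; simp; tauto, h₂, h₃, h₁⟩
      · exact ⟨w, z, u, by ext; simp; tauto, h₃, h₂, h₁⟩
      · exact ⟨z, w, u, by ext; simp; tauto, h₃, h₁, h₂⟩
    · rintro ⟨u, w, z⟩ hp ⟨u', w', z'⟩ hp' heq
      simp only [hX, Finset.coe_filter, Set.mem_ofPred_eq, Finset.mem_sigma, Finset.mem_union,
        Finset.mem_product, Finset.mem_filter] at hp hp'
      have hu := hp.1.1
      have hw : w ∈ P := by tauto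
      have hz : z ∈ Q := by tauto
      have hu' := hp'.1.1
      have hw' : w' ∈ P := by tauto
      have hz' : z' ∈ Q := by tauto
      clear hp hp'
      simp only [Finset.ext_iff, Finset.mem_insert, Finset.mem_singleton] at heq
      have e₁ := (heq u).1 (Or.inl rfl)
      have e₂ := (heq w).1 (Or.inr (Or.inl rfl))
      have e₃ := (heq z).1 (Or.inr (Or.inr rfl))
      clear heq
      have := hSP hu
      have := hSQ hu
      have := hPQ hw
      have := hSP hu'
      have := hSQ hu'
      have := hPQ hw'
      obtain rfl : u = u' := by grind
      obtain rfl : w = w' := by grind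
      obtain rfl : z = z' := by grind
      rfl
  · have hY : S.card * ∑ w ∈ P, G.nonadjIn w Q = (S ×ˢ P.sigma fun w =>
        Q.filter (fun z => ¬ G.adj w z ∧ ¬ G.adj z w)).card := by
      rw [Finset.card_product, Finset.card_sigma]
      rfl
    rw [hY]
    refine Finset.card_le_card_of_injOn (fun p => (p.1, ⟨p.2.1, p.2.2⟩)) ?_ ?_
    · rintro ⟨u, w, z⟩ hp
      simp only [hX, Finset.coe_filter, Set.mem_ofPred_eq, Finset.mem_sigma, Finset.mem_union,
        Finset.mem_product, Finset.mem_filter] at hp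
      simp only [Finset.mem_coe, Finset.mem_sigma, Finset.mem_product, Finset.mem_filter]
      tauto
    · rintro ⟨u, w, z⟩ _ ⟨u', w', z'⟩ _ heq
      simp only [Prod.mk.injEq, Sigma.mk.injEq, heq_eq_eq] at heq
      obtain ⟨rfl, rfl, rfl⟩ := heq
      rfl

theorem sum_choose_card_le_I3 (G : OrientedGraph W) {ι : Type} [Fintype ι] (V : ι → Finset W)
    (hdisj : ∀ i j, i ≠ j → Disjoint (V i) (V j))
    (hind : ∀ i, ∀ x ∈ V i, ∀ y ∈ V i, ¬ G.adj x y) :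
    ∑ i, (V i).card.choose 3 ≤ G.I3 := by
  simp only [← Finset.card_powersetCard]
  rw [← Finset.card_biUnion]
  · refine Finset.card_le_card fun s hs => ?_
    simp only [Finset.mem_biUnion, Finset.mem_univ, true_and, Finset.mem_powersetCard] at hs
    obtain ⟨i, hsi, hs⟩ := hs
    simp only [Finset.mem_filter, Finset.mem_powersetCard, Finset.subset_univ, true_and]
    exact ⟨hs, fun x hx y hy => hind i x (hsi hx) y (hsi hy)⟩
  · intro i _ j _ hij
    rw [Function.onFun, Finset.disjoint_left]
    intro s hs hs'
    rw [Finset.mem_powersetCard] at hs hs'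
    obtain ⟨x, hx⟩ : s.Nonempty := Finset.card_pos.1 (by omega)
    exact Finset.disjoint_left.1 (hdisj i j hij) (hs.1 hx) (hs'.1 hx)

/-- `G` is close to a balanced complete tripartite graph with parts `V i`, and it has few
transitive triangles. -/
structure IsNearlyTripartite (G : OrientedGraph W) (ε n : ℝ) (V : ZMod 3 → Finset W) : Prop where
  disjoint : ∀ i j, i ≠ j → Disjoint (V i) (V j)
  card_le : ∀ i, ((V i).card : ℝ) ≤ (1 / 3 + 5 * ε ^ 2) * n
  le_card : ∀ i, (1 / 3 - 15 * ε ^ 2) * n ≤ ((V i).card : ℝ)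
  le_degIn : ∀ i j, i ≠ j → ∀ u ∈ V i,
    (1 / 3 - 15 * ε ^ 2) * n ≤ (G.outDegIn u (V j) : ℝ) + G.inDegIn u (V j)
  T3_le : (G.T3 : ℝ) ≤ 37 / 100 * ε ^ 2 * n ^ 3

/-- The number of edges at `u`, a vertex of the part `V i`, which run along the cyclic order of
the parts with step `d`. -/
noncomputable def cyclicDeg (G : OrientedGraph W) (V : ZMod 3 → Finset W) (d i : ZMod 3) (u : W) :
    ℕ :=
  G.outDegIn u (V (i + d)) + G.inDegIn u (V (i - d))

/-- The vertices of `V i` at which at most half of the edges run along the cyclic order of the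
parts with step `d`. -/
noncomputable def minorityPart (G : OrientedGraph W) (V : ZMod 3 → Finset W) (d i : ZMod 3) :
    Finset W :=
  (V i).filter (fun u => G.cyclicDeg V d i u ≤ G.cyclicDeg V (-d) i u)

theorem minorityPart_subset (G : OrientedGraph W) (V : ZMod 3 → Finset W) (d i : ZMod 3) :
    G.minorityPart V d i ⊆ V i :=
  Finset.filter_subset _ _

theorem minorityPart_union_minorityPart_neg (G : OrientedGraph W) (V : ZMod 3 → Finset W)
    (d i : ZMod 3) : G.minorityPart V d i ∪ G.minorityPart V (-d) i = V i := by
  ext u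
  simp only [minorityPart, Finset.mem_union, Finset.mem_filter, neg_neg, ← and_or_left]
  exact and_iff_left (le_total _ _)

theorem ne_sub_of_ne_zero {A : Type} [AddGroup A] {d : A} (hd : d ≠ 0) (i : A) : i ≠ i - d :=
  fun h => hd (sub_eq_self.1 h.symm)

namespace IsNearlyTripartite

variable {G : OrientedGraph W} {ε n : ℝ} {V : ZMod 3 → Finset W}

theorem nonadjIn_le (h : G.IsNearlyTripartite ε n V) {i j : ZMod 3} (hij : i ≠ j) {u : W}
    (hu : u ∈ V i) : (G.nonadjIn u (V j) : ℝ) ≤ 20 * ε ^ 2 * n := by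
  have h₁ : (G.outDegIn u (V j) : ℝ) + G.inDegIn u (V j) + G.nonadjIn u (V j) = (V j).card :=
    mod_cast G.outDegIn_add_inDegIn_add_nonadjIn u (V j)
  linarith [h.card_le j, h.le_degIn i j hij u hu]

theorem outDegIn_add_inDegIn_le (h : G.IsNearlyTripartite ε n V) (u : W) (j : ZMod 3) :
    (G.outDegIn u (V j) : ℝ) + G.inDegIn u (V j) ≤ (1 / 3 + 5 * ε ^ 2) * n := by
  have h₁ : (G.outDegIn u (V j) : ℝ) + G.inDegIn u (V j) + G.nonadjIn u (V j) = (V j).card :=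
    mod_cast G.outDegIn_add_inDegIn_add_nonadjIn u (V j)
  linarith [h.card_le j, Nat.cast_nonneg (α := ℝ) (G.nonadjIn u (V j))]

theorem cyclicDeg_mul_le (h : G.IsNearlyTripartite ε n V) {d : ZMod 3} (hd : d ≠ 0) {i : ZMod 3}
    {u : W} (hu : u ∈ G.minorityPart V d i) :
    (G.cyclicDeg V d i u : ℝ) * ((1 / 6 - 35 / 2 * ε ^ 2) * n) ≤
      (G.outDegIn u (V (i + d)) : ℝ) * G.outDegIn u (V (i - d))
        + (G.inDegIn u (V (i + d)) : ℝ) * G.inDegIn u (V (i - d)) := by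
  obtain ⟨hui, hmin⟩ := Finset.mem_filter.1 hu
  unfold cyclicDeg at hmin ⊢
  rw [← sub_eq_add_neg, sub_neg_eq_add] at hmin
  have hmin' : (G.outDegIn u (V (i + d)) : ℝ) + G.inDegIn u (V (i - d)) ≤
      G.outDegIn u (V (i - d)) + G.inDegIn u (V (i + d)) := by exact_mod_cast hmin
  have l₁ := h.le_degIn i (i + d) (by simpa using hd) u hui
  have l₂ := h.le_degIn i (i - d) (ne_sub_of_ne_zero hd i) u hui
  have u₁ := h.outDegIn_add_inDegIn_le u (i + d)
  have u₂ := h.outDegIn_add_inDegIn_le u (i - d)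
  push_cast
  have a₁ : (0 : ℝ) ≤ G.outDegIn u (V (i + d)) := Nat.cast_nonneg _
  have a₂ : (0 : ℝ) ≤ G.inDegIn u (V (i - d)) := Nat.cast_nonneg _
  generalize (G.outDegIn u (V (i + d)) : ℝ) = a at *
  generalize (G.inDegIn u (V (i + d)) : ℝ) = a' at *
  generalize (G.outDegIn u (V (i - d)) : ℝ) = c at *
  generalize (G.inDegIn u (V (i - d)) : ℝ) = c' at *
  have hf : a + c' ≤ (1 / 3 + 5 * ε ^ 2) * n := by linarith
  have p₁ := mul_le_mul_of_nonneg_left (show (1 / 3 - 15 * ε ^ 2) * n - c' ≤ c by linarith) a₁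
  have p₂ := mul_le_mul_of_nonneg_right (show (1 / 3 - 15 * ε ^ 2) * n - a ≤ a' by linarith) a₂
  have p₃ := mul_le_mul_of_nonneg_left hf (add_nonneg a₁ a₂)
  nlinarith [sq_nonneg (a - c')]

theorem sum_cyclicDeg_le (h : G.IsNearlyTripartite ε n V) (hn : 0 < n) (hε : 0 < ε)
    (hε' : ε < 1 / 360) {d : ZMod 3} (hd : d ≠ 0) (i : ZMod 3) :
    ∑ u ∈ G.minorityPart V d i, (G.cyclicDeg V d i u : ℝ) ≤ 16 * ε ^ 2 * n ^ 2 := by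
  have hdd : i + d ≠ i - d := by
    revert hd; revert d i; decide
  have hi₁ : i ≠ i + d := by simpa using hd
  have hi₂ : i ≠ i - d := ne_sub_of_ne_zero hd i
  have hε2 : ε ^ 2 < 1 / 129600 := by nlinarith
  have hε0 : 0 < ε ^ 2 := by positivity
  have h₁ : ∑ u ∈ G.minorityPart V d i,
      ((G.outDegIn u (V (i + d)) : ℝ) * G.outDegIn u (V (i - d))
        + (G.inDegIn u (V (i + d)) : ℝ) * G.inDegIn u (V (i - d))) ≤
      (G.T3 : ℝ) + (V i).card * ∑ w ∈ V (i + d), (G.nonadjIn w (V (i - d)) : ℝ) := by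
    refine (Finset.sum_le_sum_of_subset_of_nonneg (G.minorityPart_subset V d i)
      fun _ _ _ => by positivity).trans ?_
    exact_mod_cast G.sum_outDegIn_mul_add_inDegIn_mul_le (h.disjoint _ _ hi₁)
      (h.disjoint _ _ hi₂) (h.disjoint _ _ hdd)
  have h₂ : ∑ w ∈ V (i + d), (G.nonadjIn w (V (i - d)) : ℝ) ≤
      (V (i + d)).card * (20 * ε ^ 2 * n) := by
    rw [← nsmul_eq_mul]
    exact Finset.sum_le_card_nsmul _ _ _ fun w hw => h.nonadjIn_le hdd hw
  have h₃ : ∑ u ∈ G.minorityPart V d i, (G.cyclicDeg V d i u : ℝ) *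
      ((1 / 6 - 35 / 2 * ε ^ 2) * n) ≤ _ := Finset.sum_le_sum fun u hu => h.cyclicDeg_mul_le hd hu
  rw [← Finset.sum_mul] at h₃
  have hc : ∀ j, ((V j).card : ℝ) ≤ 3334 / 10000 * n := fun j =>
    (h.card_le j).trans (by gcongr; linarith)
  have h₄ : ((V i).card : ℝ) * ∑ w ∈ V (i + d), (G.nonadjIn w (V (i - d)) : ℝ) ≤
      (3334 / 10000 * n) * ((3334 / 10000 * n) * (20 * ε ^ 2 * n)) := by
    refine mul_le_mul (hc i) (h₂.trans ?_) (by positivity) (by positivity)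
    gcongr
    exact hc _
  have h₅ : ∑ u ∈ G.minorityPart V d i, (G.cyclicDeg V d i u : ℝ) * (1665 / 10000 * n) ≤
      ∑ u ∈ G.minorityPart V d i, (G.cyclicDeg V d i u : ℝ) *
        ((1 / 6 - 35 / 2 * ε ^ 2) * n) := by
    gcongr
    linarith
  rw [← Finset.sum_mul, ← Finset.sum_mul] at h₅
  have h₆ := h.T3_le
  have h₇ : 0 < ε ^ 2 * n ^ 3 := by positivity
  refine le_of_mul_le_mul_right (a := 1665 / 10000 * n) ?_ (by positivity)
  nlinarith

theorem card_minorityPart_mul_le (h : G.IsNearlyTripartite ε n V) (hn : 0 < n) (hε : 0 < ε)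
    (hε' : ε < 1 / 360) (i : ZMod 3) :
    ((G.minorityPart V 1 i).card : ℝ) * (G.minorityPart V (-1) (i + 1)).card ≤
      39 * ε ^ 2 * n ^ 2 := by
  have hε2 : ε ^ 2 < 1 / 129600 := by nlinarith
  have hε0 : 0 < ε ^ 2 := by positivity
  set S := G.minorityPart V 1 i
  set T := G.minorityPart V (-1) (i + 1)
  have hS : S ⊆ V i := G.minorityPart_subset V _ _
  have hT : T ⊆ V (i + 1) := G.minorityPart_subset V _ _
  have h₀ : (S.card : ℝ) * T.card = ∑ u ∈ S, (G.outDegIn u T : ℝ)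
      + ∑ w ∈ T, (G.outDegIn w S : ℝ) + ∑ u ∈ S, (G.nonadjIn u T : ℝ) :=
    mod_cast G.card_mul_card_eq S T
  have h₁ : ∑ u ∈ S, (G.outDegIn u T : ℝ) ≤ 16 * ε ^ 2 * n ^ 2 := by
    refine le_trans (Finset.sum_le_sum fun u _ => ?_)
      (h.sum_cyclicDeg_le hn hε hε' (d := 1) (by decide) i)
    exact_mod_cast (G.outDegIn_mono u hT).trans (Nat.le_add_right _ _)
  have h₂ : ∑ w ∈ T, (G.outDegIn w S : ℝ) ≤ 16 * ε ^ 2 * n ^ 2 := by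
    refine le_trans (Finset.sum_le_sum fun w _ => ?_)
      (h.sum_cyclicDeg_le hn hε hε' (d := -1) (by decide) (i + 1))
    have hS' : S ⊆ V (i + 1 + -1) := by simpa using hS
    exact_mod_cast (G.outDegIn_mono w hS').trans (Nat.le_add_right _ _)
  have h₃ : ∑ u ∈ S, (G.nonadjIn u T : ℝ) ≤ S.card * (20 * ε ^ 2 * n) := by
    rw [← nsmul_eq_mul]
    refine Finset.sum_le_card_nsmul _ _ _ fun u hu => ?_
    refine le_trans ?_ (h.nonadjIn_le (i := i) (j := i + 1) (by simp) (hS hu))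
    exact_mod_cast G.nonadjIn_mono u hT
  have hc : (S.card : ℝ) ≤ 3334 / 10000 * n :=
    (Nat.cast_le.2 (Finset.card_le_card hS)).trans ((h.card_le i).trans (by gcongr; linarith))
  have h₄ : (S.card : ℝ) * (20 * ε ^ 2 * n) ≤ 3334 / 10000 * n * (20 * ε ^ 2 * n) := by gcongr
  have h₅ : 0 < ε ^ 2 * n ^ 2 := by positivity
  nlinarith

theorem card_le_of_mul_le {x y : ℝ} (hn : 0 < n) (hx : 0 ≤ x) (hy : 166 / 1000 * n ≤ y)
    (hxy : x * y ≤ 39 * ε ^ 2 * n ^ 2) : x ≤ 240 * ε ^ 2 * n := by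
  refine le_of_mul_le_mul_right (a := 166 / 1000 * n) ?_ (by positivity)
  have h₁ := mul_le_mul_of_nonneg_left hy hx
  nlinarith [sq_nonneg (ε * n)]

/-- One of the two cyclic orders of the parts is the majority direction at almost all vertices. -/
theorem card_minorityPart_le_or (h : G.IsNearlyTripartite ε n V) (hn : 0 < n) (hε : 0 < ε)
    (hε' : ε < 1 / 360) :
    (∀ i, ((G.minorityPart V (-1) i).card : ℝ) ≤ 240 * ε ^ 2 * n) ∨
      ∀ i, ((G.minorityPart V 1 i).card : ℝ) ≤ 240 * ε ^ 2 * n := by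
  have hε2 : ε ^ 2 < 1 / 129600 := by nlinarith
  have hmul := h.card_minorityPart_mul_le hn hε hε'
  have hsum : ∀ i, 332 / 1000 * n ≤
      ((G.minorityPart V 1 i).card : ℝ) + (G.minorityPart V (-1) i).card := by
    intro i
    refine le_trans ?_ (((h.le_card i).trans (Nat.cast_le.2 (le_of_eq_of_le (congrArg _
      (G.minorityPart_union_minorityPart_neg V 1 i).symm)
      (Finset.card_union_le _ _)))).trans_eq (Nat.cast_add _ _))
    gcongr
    linarith
  have hsmall : 240 * ε ^ 2 * n < 166 / 1000 * n := by
    gcongr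
    linarith
  have hstep : ∀ i, 166 / 1000 * n ≤ ((G.minorityPart V 1 i).card : ℝ) →
      ((G.minorityPart V (-1) (i + 1)).card : ℝ) ≤ 240 * ε ^ 2 * n ∧
      166 / 1000 * n ≤ ((G.minorityPart V 1 (i + 1)).card : ℝ) := by
    intro i hi
    have h₁ := card_le_of_mul_le (ε := ε) hn (Nat.cast_nonneg _) hi
      ((mul_comm _ _).trans_le (hmul i))
    exact ⟨h₁, by linarith [hsum (i + 1)]⟩
  by_cases hbig : ∃ i, 166 / 1000 * n ≤ ((G.minorityPart V 1 i).card : ℝ)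
  · left
    obtain ⟨i, hi⟩ := hbig
    intro j
    have hi₁ := hstep _ hi
    have hi₂ := hstep _ hi₁.2
    have hi₃ := hstep _ hi₂.2
    obtain rfl | rfl | rfl : j = i + 1 ∨ j = i + 1 + 1 ∨ j = i + 1 + 1 + 1 := by
      clear hi hi₁ hi₂ hi₃
      revert i j; decide
    exacts [hi₁.1, hi₂.1, hi₃.1]
  · right
    push Not at hbig
    exact fun i => card_le_of_mul_le hn (Nat.cast_nonneg _)
      (by linarith [hsum (i + 1), hbig (i + 1)]) (hmul i)

theorem eCount_le (h : G.IsNearlyTripartite ε n V) (hn : 0 < n) (hε : 0 < ε)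
    (hε' : ε < 1 / 360) {d : ZMod 3} (hd : d ≠ 0) {i : ZMod 3}
    (hsmall : ((G.minorityPart V (-d) i).card : ℝ) ≤ 240 * ε ^ 2 * n) :
    (G.eCount (V i) (V (i + d)) : ℝ) ≤ 4 * ε * n ^ 2 := by
  have hε2 : ε ^ 2 < 1 / 129600 := by nlinarith
  have h₁ : (G.eCount (V i) (V (i + d)) : ℝ) ≤
      ∑ u ∈ G.minorityPart V d i, (G.outDegIn u (V (i + d)) : ℝ)
        + ∑ u ∈ G.minorityPart V (-d) i, (G.outDegIn u (V (i + d)) : ℝ) := by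
    unfold eCount
    rw [← Finset.sum_union_inter, G.minorityPart_union_minorityPart_neg V d i]
    push_cast
    exact le_add_of_nonneg_right (by positivity)
  have h₂ : ∑ u ∈ G.minorityPart V d i, (G.outDegIn u (V (i + d)) : ℝ) ≤
      16 * ε ^ 2 * n ^ 2 := by
    refine le_trans (Finset.sum_le_sum fun u _ => ?_) (h.sum_cyclicDeg_le hn hε hε' hd i)
    exact_mod_cast Nat.le_add_right _ _
  have h₃ : ∑ u ∈ G.minorityPart V (-d) i, (G.outDegIn u (V (i + d)) : ℝ) ≤
      (G.minorityPart V (-d) i).card * n := by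
    rw [← nsmul_eq_mul]
    refine Finset.sum_le_card_nsmul _ _ _ fun u _ => ?_
    have := h.outDegIn_add_inDegIn_le u (i + d)
    have := Nat.cast_nonneg (α := ℝ) (G.inDegIn u (V (i + d)))
    nlinarith
  have h₄ : ((G.minorityPart V (-d) i).card : ℝ) * n ≤ 240 * ε ^ 2 * n * n := by gcongr
  have h₅ : ε ^ 2 * n ^ 2 ≤ 1 / 360 * ε * n ^ 2 := by
    gcongr
    nlinarith
  nlinarith

theorem card_filter_lt_le (h : G.IsNearlyTripartite ε n V) (hn : 0 < n) (hε : 0 < ε)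
    (hε' : ε < 1 / 360) {d : ZMod 3} (hd : d ≠ 0) {i j : ZMod 3} (hij : i ≠ j)
    (hsmall : ((G.minorityPart V (-d) i).card : ℝ) ≤ 240 * ε ^ 2 * n) {g g' : W → ℕ}
    (hg : ∀ u, (g u : ℝ) + g' u = (G.outDegIn u (V j) : ℝ) + G.inDegIn u (V j))
    (hg' : ∀ u, g' u ≤ G.cyclicDeg V d i u) :
    (((V i).filter (fun u => (g u : ℝ) < (1 / 3 - 4 * ε - 15 * ε ^ 2) * n)).card : ℝ) ≤
      15 / 2 * ε * n := by
  set T := (V i).filter (fun u => (g u : ℝ) < (1 / 3 - 4 * ε - 15 * ε ^ 2) * n) with hT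
  set R := (G.minorityPart V d i).filter (fun u => u ∈ T) with hR
  have h₁ : (T.card : ℝ) ≤ R.card + (G.minorityPart V (-d) i).card := by
    have hsub : T ⊆ R ∪ G.minorityPart V (-d) i := by
      intro u hu
      have hu' : u ∈ V i := (Finset.mem_filter.1 hu).1
      rw [← G.minorityPart_union_minorityPart_neg V d i, Finset.mem_union] at hu'
      rw [Finset.mem_union, hR, Finset.mem_filter]
      tauto
    exact_mod_cast (Finset.card_le_card hsub).trans (Finset.card_union_le _ _)
  have h₂ : (R.card : ℝ) * (4 * ε * n) ≤ 16 * ε ^ 2 * n ^ 2 := by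
    refine le_trans ?_ (h.sum_cyclicDeg_le hn hε hε' hd i)
    rw [← nsmul_eq_mul]
    refine le_trans (Finset.card_nsmul_le_sum R (fun u => (G.cyclicDeg V d i u : ℝ)) _ ?_)
      (Finset.sum_le_sum_of_subset_of_nonneg (Finset.filter_subset _ _)
        fun _ _ _ => Nat.cast_nonneg _)
    intro u hu
    obtain ⟨hui, hlt⟩ := Finset.mem_filter.1 (Finset.mem_filter.1 hu).2
    have h₃ := h.le_degIn i j hij u hui
    have h₄ : (g' u : ℝ) ≤ G.cyclicDeg V d i u := by exact_mod_cast hg' u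
    nlinarith [hg u]
  have h₃ : (R.card : ℝ) ≤ 4 * ε * n := by
    refine le_of_mul_le_mul_right (a := 4 * ε * n) ?_ (by positivity)
    nlinarith
  have h₄ : ε ^ 2 * n ≤ 1 / 360 * ε * n := by
    gcongr
    nlinarith
  have h₅ : 0 < ε * n := by positivity
  linarith

theorem card_filter_outDegIn_lt_le (h : G.IsNearlyTripartite ε n V) (hn : 0 < n) (hε : 0 < ε)
    (hε' : ε < 1 / 360) {d : ZMod 3} (hd : d ≠ 0) {i : ZMod 3}
    (hsmall : ((G.minorityPart V (-d) i).card : ℝ) ≤ 240 * ε ^ 2 * n) :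
    (((V i).filter (fun u => (G.outDegIn u (V (i - d)) : ℝ) <
      (1 / 3 - 4 * ε - 15 * ε ^ 2) * n)).card : ℝ) ≤ 15 / 2 * ε * n :=
  h.card_filter_lt_le hn hε hε' hd (j := i - d) (ne_sub_of_ne_zero hd i) hsmall
    (fun _ => rfl) fun _ => Nat.le_add_left _ _

theorem card_filter_inDegIn_lt_le (h : G.IsNearlyTripartite ε n V) (hn : 0 < n) (hε : 0 < ε)
    (hε' : ε < 1 / 360) {d : ZMod 3} (hd : d ≠ 0) {i : ZMod 3}
    (hsmall : ((G.minorityPart V (-d) i).card : ℝ) ≤ 240 * ε ^ 2 * n) :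
    (((V i).filter (fun u => (G.inDegIn u (V (i + d)) : ℝ) <
      (1 / 3 - 4 * ε - 15 * ε ^ 2) * n)).card : ℝ) ≤ 15 / 2 * ε * n :=
  h.card_filter_lt_le hn hε hε' hd (j := i + d) (by simpa using hd) hsmall
    (fun _ => add_comm _ _) fun _ => Nat.le_add_right _ _

end IsNearlyTripartite

theorem six_mul_choose_three_le (m : ℕ) : 6 * (m.choose 3 : ℝ) ≤ (m : ℝ) ^ 3 := by
  have h := Nat.choose_le_pow_div (α := ℝ) 3 m
  norm_num [Nat.factorial] at h
  linarith

theorem le_six_mul_choose_three (m : ℕ) :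
    (m : ℝ) ^ 3 - 3 * (m : ℝ) ^ 2 ≤ 6 * (m.choose 3 : ℝ) := by
  induction m with
  | zero => simp
  | succ k ih =>
    have h₁ : ((k + 1).choose 3 : ℝ) = k.choose 2 + k.choose 3 := by
      exact_mod_cast Nat.choose_succ_succ k 2
    rw [h₁, Nat.cast_choose_two]
    push_cast
    nlinarith [Nat.cast_nonneg (α := ℝ) k]

theorem T3_le_of_dens_le (G : OrientedGraph W) {ε n : ℝ} (hn : 2 / ε ^ 2 ≤ n) (hε : 0 < ε)
    (hε' : ε < 1 / 360) (hW : (Fintype.card W : ℝ) = n)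
    (hdens : G.tDens + G.iDens ≤ 1 / 9 + ε ^ 6) {V : ZMod 3 → Finset W}
    (hdisj : ∀ i j, i ≠ j → Disjoint (V i) (V j))
    (hind : ∀ i, ∀ x ∈ V i, ∀ y ∈ V i, ¬ G.adj x y)
    (hcard : ∀ i, ((V i).card : ℝ) ≤ (1 / 3 + 5 * ε ^ 2) * n)
    (hsum : (1 - 5 * ε ^ 2) * n ≤ (V 0).card + (V 1).card + (V 2).card) :
    (G.T3 : ℝ) ≤ 37 / 100 * ε ^ 2 * n ^ 3 := by
  have hε2 : ε ^ 2 < 1 / 129600 := by nlinarith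
  have hε0 : 0 < ε ^ 2 := by positivity
  have hn2 : 2 ≤ n * ε ^ 2 := by rwa [div_le_iff₀ hε0] at hn
  have hn3 : 3 ≤ n := by nlinarith
  have hn0 : 0 < n := by linarith
  have hpos : 0 < ((Fintype.card W).choose 3 : ℝ) := by
    have : 3 ≤ Fintype.card W := by exact_mod_cast hn3.trans_eq hW.symm
    exact_mod_cast Nat.choose_pos this
  have h₁ : (G.T3 : ℝ) + G.I3 ≤ (1 / 9 + ε ^ 6) * (Fintype.card W).choose 3 := by
    unfold tDens iDens at hdens
    rwa [← add_div, div_le_iff₀ hpos] at hdens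
  have h₂ : 6 * ((Fintype.card W).choose 3 : ℝ) ≤ n ^ 3 :=
    hW ▸ six_mul_choose_three_le (Fintype.card W)
  have h₃ : 6 * ((1 / 9 + ε ^ 6) * (Fintype.card W).choose 3 : ℝ) ≤ (1 / 9 + ε ^ 6) * n ^ 3 := by
    rw [mul_left_comm]
    gcongr
  have h₄ : ((V 0).card.choose 3 : ℝ) + (V 1).card.choose 3 + (V 2).card.choose 3 ≤ G.I3 := by
    have := G.sum_choose_card_le_I3 V hdisj hind
    rw [show (∑ i, (V i).card.choose 3) = (V 0).card.choose 3 + (V 1).card.choose 3 +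
      (V 2).card.choose 3 from Fin.sum_univ_three _] at this
    exact_mod_cast this
  have h₅ : ∀ i, n ^ 3 / 27 + n ^ 2 / 3 * ((V i).card - n / 3) - 34 / 100 * n ^ 2 ≤
      6 * ((V i).card.choose 3 : ℝ) := by
    intro i
    refine le_trans ?_ (le_six_mul_choose_three _)
    have hc : ((V i).card : ℝ) ≤ 3334 / 10000 * n := (hcard i).trans (by gcongr; linarith)
    have hc0 : (0 : ℝ) ≤ (V i).card := Nat.cast_nonneg _
    generalize ((V i).card : ℝ) = v at hc hc0 ⊢
    have h₁ : 0 ≤ (v - n / 3) ^ 2 * (v + 2 * n / 3) := by positivity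
    nlinarith
  have h₆ : n ^ 2 / 3 * ((1 - 5 * ε ^ 2) * n) ≤
      n ^ 2 / 3 * ((V 0).card + (V 1).card + (V 2).card) := by gcongr
  have h₇ : 2 * n ^ 2 ≤ ε ^ 2 * n ^ 3 := by nlinarith [sq_nonneg n]
  have h₈ : ε ^ 6 * n ^ 3 ≤ 1 / 1000 * ε ^ 2 * n ^ 3 := by
    gcongr
    have : ε ^ 2 * ε ^ 2 ≤ 1 / 129600 * 1 := by gcongr; linarith
    nlinarith
  have h₉ : 0 < ε ^ 2 * n ^ 3 := by positivity
  nlinarith [h₅ 0, h₅ 1, h₅ 2]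

theorem deg_eq_outDegIn_add_inDegIn (G : OrientedGraph W) (u : W) :
    G.deg u = G.outDegIn u Finset.univ + G.inDegIn u Finset.univ := rfl

theorem outDegIn_add_inDegIn_le_card (G : OrientedGraph W) (u : W) (S : Finset W) :
    G.outDegIn u S + G.inDegIn u S ≤ S.card :=
  (Nat.le_add_right _ _).trans_eq (G.outDegIn_add_inDegIn_add_nonadjIn u S)

theorem deg_le_of_cover (G : OrientedGraph W) (u : W) {S T : Finset W}
    (h : S ∪ T = Finset.univ) : G.deg u ≤ G.outDegIn u S + G.inDegIn u S + T.card := by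
  have h₁ := G.outDegIn_union_le u S T
  have h₂ := G.inDegIn_union_le u S T
  have h₃ := G.outDegIn_add_inDegIn_le_card u T
  rw [h] at h₁ h₂
  rw [deg_eq_outDegIn_add_inDegIn]
  omega

theorem deg_add_card_le (G : OrientedGraph W) {S : Finset W} {u : W} (hu : u ∈ S)
    (hS : ∀ x ∈ S, ∀ y ∈ S, ¬ G.adj x y) : G.deg u + S.card ≤ Fintype.card W := by
  have h₁ := G.deg_le_of_cover u (Finset.union_compl S)
  have h₂ : G.outDegIn u S = 0 :=
    Finset.card_eq_zero.2 (Finset.filter_eq_empty_iff.2 fun w hw => hS u hu w hw)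
  have h₃ : G.inDegIn u S = 0 :=
    Finset.card_eq_zero.2 (Finset.filter_eq_empty_iff.2 fun w hw => hS w hw u hu)
  have := Finset.card_add_card_compl S
  omega

theorem isNearlyTripartite (G : OrientedGraph W) {ε n : ℝ} (hn : 2 / ε ^ 2 ≤ n) (hε : 0 < ε)
    (hε' : ε < 1 / 360) (hW : (Fintype.card W : ℝ) = n)
    (hdens : G.tDens + G.iDens ≤ 1 / 9 + ε ^ 6) {V : ZMod 3 → Finset W} {B : Finset W}
    (hB : ∀ v, v ∉ B → (2 / 3 - 5 * ε ^ 2) * n ≤ G.deg v)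
    (hBcard : (B.card : ℝ) ≤ 5 * ε ^ 2 * n)
    (hdisj : ∀ i j, i ≠ j → Disjoint (V i) (V j))
    (hcover : ∀ v, v ∉ B ↔ ∃ i, v ∈ V i)
    (hind : ∀ i, ∀ x ∈ V i, ∀ y ∈ V i, ¬ G.adj x y) :
    G.IsNearlyTripartite ε n V := by
  have hn0 : 0 < n := lt_of_lt_of_le (by positivity) hn
  have hdeg : ∀ i, ∀ u ∈ V i, (2 / 3 - 5 * ε ^ 2) * n ≤ G.deg u := fun i u hu =>
    hB u ((hcover u).2 ⟨i, hu⟩)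
  have hcard : ∀ i, ((V i).card : ℝ) ≤ (1 / 3 + 5 * ε ^ 2) * n := by
    intro i
    rcases (V i).eq_empty_or_nonempty with h | ⟨u, hu⟩
    · rw [h, Finset.card_empty, Nat.cast_zero]
      positivity
    · have h₁ : (G.deg u : ℝ) + (V i).card ≤ n := by
        rw [← hW]
        exact_mod_cast G.deg_add_card_le hu (hind i)
      linarith [hdeg i u hu]
  have hthird : ∀ i j : ZMod 3, i ≠ j → ∃ k, ∀ l, l = i ∨ l = j ∨ l = k := by decide
  have huniv : ∀ i j k : ZMod 3, (∀ l, l = i ∨ l = j ∨ l = k) →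
      V i ∪ (V j ∪ (V k ∪ B)) = Finset.univ := by
    intro i j k h
    refine Finset.eq_univ_of_forall fun v => ?_
    simp only [Finset.mem_union]
    by_cases hv : v ∈ B
    · tauto
    · obtain ⟨l, hl⟩ := (hcover v).1 hv
      rcases h l with rfl | rfl | rfl <;> tauto
  have hsum : ∀ i j k : ZMod 3, (∀ l, l = i ∨ l = j ∨ l = k) →
      n ≤ (V i).card + (V j).card + (V k).card + B.card := by
    intro i j k h
    have h₁ := congrArg Finset.card (huniv i j k h)
    rw [Finset.card_univ] at h₁
    have h₂ := Finset.card_union_le (V i) (V j ∪ (V k ∪ B))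
    have h₃ := Finset.card_union_le (V j) (V k ∪ B)
    have h₄ := Finset.card_union_le (V k) B
    rw [← hW]
    exact_mod_cast (by omega :
      Fintype.card W ≤ (V i).card + (V j).card + (V k).card + B.card)
  refine ⟨hdisj, hcard, fun i => ?_, fun i j hij u hu => ?_, ?_⟩
  · obtain ⟨k, hk⟩ := hthird i (i + 1) (by simp)
    linarith [hsum _ _ _ hk, hcard (i + 1), hcard k]
  · obtain ⟨k, hk⟩ := hthird i j hij
    have h₁ := G.deg_le_of_cover u (S := V j ∪ V i) (T := V k ∪ B) (by
      rw [← huniv i j k hk]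
      ext
      simp only [Finset.mem_union]
      tauto)
    have h₂ := G.outDegIn_union_le u (V j) (V i)
    have h₃ := G.inDegIn_union_le u (V j) (V i)
    have h₄ : G.outDegIn u (V i) = 0 :=
      Finset.card_eq_zero.2 (Finset.filter_eq_empty_iff.2 fun w hw => hind i u hu w hw)
    have h₅ : G.inDegIn u (V i) = 0 :=
      Finset.card_eq_zero.2 (Finset.filter_eq_empty_iff.2 fun w hw => hind i w hw u hu)
    have h₆ := Finset.card_union_le (V k) B
    have h₇ : (G.deg u : ℝ) ≤
        G.outDegIn u (V j) + G.inDegIn u (V j) + (V k).card + B.card := by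
      exact_mod_cast (by omega :
        G.deg u ≤ G.outDegIn u (V j) + G.inDegIn u (V j) + (V k).card + B.card)
    linarith [hdeg i u hu, hcard k]
  · exact G.T3_le_of_dens_le hn hε hε' hW hdens hdisj hind hcard
      (by linarith [hsum 0 1 2 (by decide)])

end OrientedGraph

/-- Second part of the key lemma: under the hypotheses, either the three edge
classes going "backwards" or those going "forwards" are few, and in each case
in every part almost all vertices have large out- and in-degree into the
appropriate neighbouring part (indices mod 3). -/
theorem stmt_15 {n : ℕ} (ε : ℝ) (hε : 0 < ε) (hε' : ε < 1 / 360)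
    (hn : 2 / ε ^ 2 ≤ (n : ℝ)) (G : OrientedGraph (Fin n))
    (hGti : G.tDens + G.iDens ≤ 1 / 9 + ε ^ 6)
    (B : Finset (Fin n))
    (hB : B = Finset.univ.filter
      (fun v => (G.deg v : ℝ) < (2 / 3 - 5 * ε ^ 2) * (n : ℝ)))
    (hBcard : (B.card : ℝ) ≤ 5 * ε ^ 2 * (n : ℝ))
    (Vf : ZMod 3 → Finset (Fin n))
    (hdisj : ∀ i j : ZMod 3, i ≠ j → Disjoint (Vf i) (Vf j))
    (hcover : ∀ v : Fin n, v ∉ B ↔ ∃ i : ZMod 3, v ∈ Vf i)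
    (hind : ∀ i : ZMod 3, ∀ x ∈ Vf i, ∀ y ∈ Vf i, ¬ G.adj x y) :
    ((G.eCount (Vf 0) (Vf 1) + G.eCount (Vf 1) (Vf 2) + G.eCount (Vf 2) (Vf 0) : ℝ)
          ≤ 12 * ε * (n : ℝ) ^ 2 ∧
        ∀ i : ZMod 3,
          ((((Vf i).filter (fun u =>
              (G.outDegIn u (Vf (i - 1)) : ℝ) < (1 / 3 - 4 * ε - 15 * ε ^ 2) * (n : ℝ))).card : ℝ)
              ≤ (15 / 2) * ε * (n : ℝ)) ∧
          ((((Vf i).filter (fun u =>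
              (G.inDegIn u (Vf (i + 1)) : ℝ) < (1 / 3 - 4 * ε - 15 * ε ^ 2) * (n : ℝ))).card : ℝ)
              ≤ (15 / 2) * ε * (n : ℝ))) ∨
      ((G.eCount (Vf 1) (Vf 0) + G.eCount (Vf 2) (Vf 1) + G.eCount (Vf 0) (Vf 2) : ℝ)
          ≤ 12 * ε * (n : ℝ) ^ 2 ∧
        ∀ i : ZMod 3,
          ((((Vf i).filter (fun u =>
              (G.outDegIn u (Vf (i + 1)) : ℝ) < (1 / 3 - 4 * ε - 15 * ε ^ 2) * (n : ℝ))).card : ℝ)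
              ≤ (15 / 2) * ε * (n : ℝ)) ∧
          ((((Vf i).filter (fun u =>
              (G.inDegIn u (Vf (i - 1)) : ℝ) < (1 / 3 - 4 * ε - 15 * ε ^ 2) * (n : ℝ))).card : ℝ)
              ≤ (15 / 2) * ε * (n : ℝ))) := by
  have hn0 : 0 < (n : ℝ) := lt_of_lt_of_le (by positivity) hn
  have h : G.IsNearlyTripartite ε n Vf := by
    refine G.isNearlyTripartite hn hε hε' (by simp) hGti (fun v hv => ?_) hBcard hdisj hcover hind
    rw [hB, Finset.mem_filter] at hv
    simpa using hv
  rcases h.card_minorityPart_le_or hn0 hε hε' with hs | hs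
  · left
    have hd : (1 : ZMod 3) ≠ 0 := by decide
    refine ⟨?_, fun i => ⟨h.card_filter_outDegIn_lt_le hn0 hε hε' hd (hs i),
      h.card_filter_inDegIn_lt_le hn0 hε hε' hd (hs i)⟩⟩
    have h₀ : (G.eCount (Vf 0) (Vf 1) : ℝ) ≤ _ := h.eCount_le hn0 hε hε' hd (hs 0)
    have h₁ : (G.eCount (Vf 1) (Vf 2) : ℝ) ≤ _ := h.eCount_le hn0 hε hε' hd (hs 1)
    have h₂ : (G.eCount (Vf 2) (Vf 0) : ℝ) ≤ _ := h.eCount_le hn0 hε hε' hd (hs 2)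
    linarith
  · right
    have hd : (-1 : ZMod 3) ≠ 0 := by decide
    replace hs : ∀ i, ((G.minorityPart Vf (- -1) i).card : ℝ) ≤ 240 * ε ^ 2 * n := by
      simpa using hs
    refine ⟨?_, fun i => ⟨?_, ?_⟩⟩
    · have h₀ : (G.eCount (Vf 1) (Vf 0) : ℝ) ≤ _ := h.eCount_le hn0 hε hε' hd (hs 1)
      have h₁ : (G.eCount (Vf 2) (Vf 1) : ℝ) ≤ _ := h.eCount_le hn0 hε hε' hd (hs 2)
      have h₂ : (G.eCount (Vf 0) (Vf 2) : ℝ) ≤ _ := h.eCount_le hn0 hε hε' hd (hs 0)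
      linarith
    · simpa only [sub_neg_eq_add] using h.card_filter_outDegIn_lt_le hn0 hε hε' hd (hs i)
    · simpa only [← sub_eq_add_neg] using h.card_filter_inDegIn_lt_le hn0 hε hε' hd (hs i)
end

section
/- For every 0 < ε < 1/360 there exist a positive integer n₀ and δ > 0 such that the following holds for every n ≥ n₀. If G is an oriented graph on an n-element vertex set V with t(G) + i(G) ≤ 1/9 + δ, then V is the disjoint union of four sets B, V₀, V₁, V₂ and there is an oriented graph G̃ obtained from G by deleting at most (1/12)ε⁶·n² edges such that (with indices mod 3 and E_{G̃}(V_i,V_j) the set of edges of G̃ directed from V_i to V_j): (1) G̃ has at least (1/3)n² − (1/15)ε·n² edges and |E_{G̃}(V₁,V₀)| + |E_{G̃}(V₂,V₁)| + |E_{G̃}(V₀,V₂)| ≤ 12ε·n²; (2) for every i ∈ {0,1,2}, V_i is independent in G̃ and (1/3 − 15ε²)·n ≤ |V_i| ≤ (1/3 + 5ε²)·n; (3) |B| ≤ 5ε²·n and for every i ∈ {0,1,2}: |{u ∈ V_i : d⁺_{G̃}(u,V_{i+1}) < (1/3 − 4ε − 15ε²)·n}| ≤ (15/2)ε·n and |{u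 ∈ V_i : d⁻_{G̃}(u,V_{i−1}) < (1/3 − 4ε − 15ε²)·n}| ≤ (15/2)ε·n. -/
open scoped Classical

/-- The total number of (directed) edges of an oriented graph. -/
noncomputable def OrientedGraph.edgeCount {V : Type} [Fintype V] [DecidableEq V]
    (G : OrientedGraph V) : ℕ :=
  ∑ v : V, G.outDeg v

/-- `2` on non-adjacent pairs and `-1` on adjacent pairs. -/
def sparsity : Fin 3 → ℤ := ![2, -1, -1]

/-- `1` on outgoing edges and `-1` on incoming edges. -/
def flow : Fin 3 → ℤ := ![0, 1, -1]

/-- Whether the colours `x`, `y`, `z` of the pairs `ab`, `ac`, `bc` are incompatible with the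
blow-up of a cyclic triangle. -/
def deviant (x y z : Fin 3) : ℤ := if z = y - x then 0 else 1

/-- Whether the colours `x`, `y`, `z` of the pairs `ab`, `ac`, `bc` are those of a transitive
triangle or of an independent triple. -/
def monotoneTriple (x y z : Fin 3) : ℤ :=
  if (x = 0 ∧ y = 0 ∧ z = 0) ∨ (x ≠ 0 ∧ y ≠ 0 ∧ z ≠ 0 ∧ z ≠ y - x) then 1 else 0

/-- The sum over the three vertices of a triple of `h` at one pair times `h` at the other pair
containing the vertex. -/
def cherrySum (h : Fin 3 → ℤ) (x y z : Fin 3) : ℤ :=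
  h x * h y + h (-x) * h z + h (-y) * h (-z)

/-! The linear forms whose squares make up the certificate of the four-vertex inequality. -/

def edgeForm₁ : Fin 3 → Fin 3 → ℤ := ![![0, 1, 1], ![-1, 0, 0], ![-1, 0, 0]]
def edgeForm₂ : Fin 3 → Fin 3 → ℤ := ![![0, 1, -1], ![1, 0, 0], ![-1, 0, 0]]
def edgeForm₃ : Fin 3 → Fin 3 → ℤ := ![![1, 0, 1], ![1, -1, -1], ![0, -2, -1]]
def edgeForm₄ : Fin 3 → Fin 3 → ℤ := ![![1, -1, 0], ![0, -1, 0], ![-1, 0, -1]]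
def nonEdgeForm₁ : Fin 3 → Fin 3 → ℤ := ![![0, 1, -1], ![1, 1, 0], ![-1, 0, -1]]
def nonEdgeForm₂ : Fin 3 → Fin 3 → ℤ := ![![2, 0, 0], ![0, -1, 0], ![0, 0, -1]]

/-- The quadratic form attached to an edge `a → b`, evaluated at the colours `(y, z)` of
`(ac, bc)` and `(y', z')` of `(ad, bd)`. -/
def edgeKernel (y z y' z' : Fin 3) : ℤ :=
  22 * (edgeForm₁ y z * edgeForm₁ y' z') + 12 * (edgeForm₂ y z * edgeForm₂ y' z') +
    6 * (edgeForm₃ y z * edgeForm₃ y' z') + 30 * (edgeForm₄ y z * edgeForm₄ y' z')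

/-- The quadratic form attached to a non-adjacent pair. -/
def nonEdgeKernel (y z y' z' : Fin 3) : ℤ :=
  5 * (nonEdgeForm₁ y z * nonEdgeForm₁ y' z') + 7 * (nonEdgeForm₂ y z * nonEdgeForm₂ y' z') +
    15 * (edgeForm₁ y z * edgeForm₁ y' z') + 10 * (edgeForm₂ y z * edgeForm₂ y' z')

/-- The quadratic form attached to a pair of colour `x`. -/
def pairKernel : Fin 3 → Fin 3 → Fin 3 → Fin 3 → Fin 3 → ℤ
  | 0, y, z, y', z' => 2 * nonEdgeKernel y z y' z'
  | 1, y, z, y', z' => edgeKernel y z y' z'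
  | 2, y, z, y', z' => edgeKernel z y z' y'

/-- The contribution of a triple to the four-vertex inequality. -/
def tripleExcess (x y z : Fin 3) : ℤ :=
  108 * monotoneTriple x y z - 12 - (7 * cherrySum flow x y z + cherrySum sparsity x y z)

set_option maxRecDepth 100000 in
/-- The four-vertex inequality, checked over all colourings of the six pairs. -/
theorem pairKernel_le_tripleExcess : ∀ ab ac ad bc bd cd : Fin 3,
    pairKernel ab ac bc ad bd + pairKernel ac ab (-bc) ad cd + pairKernel ad ab (-bd) ac (-cd) +
      pairKernel bc (-ab) (-ac) bd cd + pairKernel bd (-ab) (-ad) bc (-cd) +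
      pairKernel cd (-ac) (-ad) (-bc) (-bd) ≤
    tripleExcess ab ac bc + tripleExcess ab ad bd + tripleExcess ac ad cd +
      tripleExcess bc bd cd := by
  decide +kernel

theorem deviant_le : ∀ x y z : Fin 3,
    9 * deviant x y z ≤ 135 * monotoneTriple x y z - 15 +
      8 * (sparsity x + sparsity y + sparsity z) -
      14 * cherrySum sparsity x y z - 27 * cherrySum flow x y z := by
  decide +kernel

section ColorSums

variable {V : Type} [Fintype V]

theorem sum_mul_sum_self_nonneg (f : V → ℤ) : 0 ≤ ∑ c, ∑ d, f c * f d := by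
  rw [← Finset.sum_mul_sum]
  exact mul_self_nonneg _

theorem sum_pairKernel_nonneg (x : Fin 3) (y z : V → Fin 3) :
    0 ≤ ∑ c, ∑ d, pairKernel x (y c) (z c) (y d) (z d) := by
  have key : ∀ (k₁ k₂ k₃ k₄ : ℕ) (f₁ f₂ f₃ f₄ : V → ℤ),
      0 ≤ ∑ c, ∑ d, ((k₁ : ℤ) * (f₁ c * f₁ d) + k₂ * (f₂ c * f₂ d) +
        k₃ * (f₃ c * f₃ d) + k₄ * (f₄ c * f₄ d)) := by
    intro k₁ k₂ k₃ k₄ f₁ f₂ f₃ f₄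
    have h := fun (k : ℕ) (f : V → ℤ) =>
      mul_nonneg (Nat.cast_nonneg (α := ℤ) k) (sum_mul_sum_self_nonneg f)
    simp only [Finset.mul_sum] at h
    simp only [Finset.sum_add_distrib]
    linarith [h k₁ f₁, h k₂ f₂, h k₃ f₃, h k₄ f₄]
  have hN := key 5 7 15 10 (fun c => nonEdgeForm₁ (y c) (z c)) (fun c => nonEdgeForm₂ (y c) (z c))
    (fun c => edgeForm₁ (y c) (z c)) (fun c => edgeForm₂ (y c) (z c))
  have hE : ∀ y z : V → Fin 3, _ := fun y z =>
    key 22 12 6 30 (fun c => edgeForm₁ (y c) (z c)) (fun c => edgeForm₂ (y c) (z c))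
    (fun c => edgeForm₃ (y c) (z c)) (fun c => edgeForm₄ (y c) (z c))
  fin_cases x
  · simp only [pairKernel, nonEdgeKernel, ← Finset.mul_sum]
    exact mul_nonneg zero_le_two hN
  · exact hE y z
  · exact hE z y

variable (χ : V → V → Fin 3)

theorem sum_cherrySum (hχ : ∀ u v, χ v u = -χ u v) (h : Fin 3 → ℤ) :
    ∑ a, ∑ b, ∑ c, cherrySum h (χ a b) (χ a c) (χ b c) = 3 * ∑ a, (∑ b, h (χ a b)) ^ 2 := by
  have e : ∀ a b c, cherrySum h (χ a b) (χ a c) (χ b c) =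
      h (χ a b) * h (χ a c) + h (χ b a) * h (χ b c) + h (χ c a) * h (χ c b) := by
    intro a b c
    rw [cherrySum, hχ a b, hχ a c, hχ b c]
  simp only [e, Finset.sum_add_distrib]
  have h₁ : ∑ a, ∑ b, ∑ c, h (χ a b) * h (χ a c) = ∑ a, (∑ b, h (χ a b)) ^ 2 := by
    simp only [sq, Finset.sum_mul_sum]
  have h₂ : ∑ a, ∑ b, ∑ c, h (χ b a) * h (χ b c) = ∑ a, (∑ b, h (χ a b)) ^ 2 := by
    rw [Finset.sum_comm]
    exact h₁
  have h₃ : ∑ a, ∑ b, ∑ c, h (χ c a) * h (χ c b) = ∑ a, (∑ b, h (χ a b)) ^ 2 := by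
    rw [← h₁, Finset.sum_comm_cycle]
  rw [h₁, h₂, h₃]
  ring

/-- An asymptotic lower bound on the number of transitive triangles and independent triples,
with a stability term. -/
theorem sum_sq_sparsity_le (hχ : ∀ u v, χ v u = -χ u v) :
    ∑ a, (∑ b, sparsity (χ a b)) ^ 2 ≤
      36 * ∑ a, ∑ b, ∑ c, monotoneTriple (χ a b) (χ a c) (χ b c) - 4 * (Fintype.card V : ℤ) ^ 3 := by
  rcases isEmpty_or_nonempty V with hV | hV
  · simp
  set A : V → V → V → ℤ := fun a b c => tripleExcess (χ a b) (χ a c) (χ b c) with hA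
  set K : V → V → V → V → ℤ := fun a b c d =>
    pairKernel (χ a b) (χ a c) (χ b c) (χ a d) (χ b d) with hK
  have hle : ∀ a b c d, K a b c d + K a c b d + K a d b c + K b c a d + K b d a c + K c d a b ≤
      A a b c + A a b d + A a c d + A b c d := by
    intro a b c d
    have := pairKernel_le_tripleExcess (χ a b) (χ a c) (χ a d) (χ b c) (χ b d) (χ c d)
    simpa only [← hχ] using this
  have hK₀ : ∀ a b, 0 ≤ ∑ c, ∑ d, K a b c d := fun a b => sum_pairKernel_nonneg _ _ _
  have hsum := Finset.sum_le_sum fun a (_ : a ∈ Finset.univ) =>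
    Finset.sum_le_sum fun b (_ : b ∈ Finset.univ) =>
    Finset.sum_le_sum fun c (_ : c ∈ Finset.univ) =>
    Finset.sum_le_sum fun d (_ : d ∈ Finset.univ) => hle a b c d
  have swap₂ : ∀ F : V → V → V → V → ℤ,
      ∑ a, ∑ b, ∑ c, ∑ d, F a b c d = ∑ a, ∑ b, ∑ c, ∑ d, F a c b d :=
    fun F => Finset.sum_congr rfl fun a _ => Finset.sum_comm
  have swap₃ : ∀ F : V → V → V → V → ℤ,
      ∑ a, ∑ b, ∑ c, ∑ d, F a b c d = ∑ a, ∑ b, ∑ c, ∑ d, F a b d c :=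
    fun F => Finset.sum_congr rfl fun a _ => Finset.sum_congr rfl fun b _ => Finset.sum_comm
  have swap₁ : ∀ F : V → V → V → V → ℤ,
      ∑ a, ∑ b, ∑ c, ∑ d, F a b c d = ∑ a, ∑ b, ∑ c, ∑ d, F b a c d :=
    fun F => Finset.sum_comm
  have k₁ : 0 ≤ ∑ a, ∑ b, ∑ c, ∑ d, K a b c d :=
    Finset.sum_nonneg fun a _ => Finset.sum_nonneg fun b _ => hK₀ a b
  have k₂ := k₁.trans_eq (swap₂ K)
  have k₃ := k₂.trans_eq (swap₃ _)
  have k₄ := k₂.trans_eq (swap₁ _)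
  have k₅ := k₄.trans_eq (swap₃ _)
  have k₆ := k₅.trans_eq (swap₂ _)
  have t₁ : ∑ a, ∑ b, ∑ c, ∑ d : V, A a b c = Fintype.card V * ∑ a, ∑ b, ∑ c, A a b c := by
    simp only [Finset.sum_const, Finset.card_univ, nsmul_eq_mul, ← Finset.mul_sum]
  have t₂ := (swap₃ fun a b c _ => A a b c).symm.trans t₁
  have t₃ := (swap₂ fun a b _ d => A a b d).symm.trans t₂
  have t₄ := (swap₁ fun a _ c d => A a c d).symm.trans t₃
  simp only [Finset.sum_add_distrib] at hsum
  have hA₀ : 0 ≤ ∑ a, ∑ b, ∑ c, A a b c := by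
    have hn : (0 : ℤ) < Fintype.card V := by exact_mod_cast Fintype.card_pos
    by_contra hneg
    have := mul_neg_of_pos_of_neg hn (not_le.1 hneg)
    linarith
  simp only [hA, tripleExcess, Finset.sum_add_distrib, Finset.sum_sub_distrib, ← Finset.mul_sum,
    sum_cherrySum χ hχ, Finset.sum_const, Finset.card_univ, nsmul_eq_mul] at hA₀
  have hflow : 0 ≤ ∑ a, (∑ b, flow (χ a b)) ^ 2 := Finset.sum_nonneg fun _ _ => sq_nonneg _
  linarith

theorem sum_deviant_le (hχ : ∀ u v, χ v u = -χ u v) :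
    9 * ∑ a, ∑ b, ∑ c, deviant (χ a b) (χ a c) (χ b c) ≤
      135 * ∑ a, ∑ b, ∑ c, monotoneTriple (χ a b) (χ a c) (χ b c) -
        15 * (Fintype.card V : ℤ) ^ 3 +
        24 * (Fintype.card V * ∑ a, ∑ b, sparsity (χ a b)) := by
  have hsum := Finset.sum_le_sum fun a (_ : a ∈ Finset.univ) =>
    Finset.sum_le_sum fun b (_ : b ∈ Finset.univ) =>
    Finset.sum_le_sum fun c (_ : c ∈ Finset.univ) => deviant_le (χ a b) (χ a c) (χ b c)
  have hlast : ∑ a : V, ∑ b, ∑ c, sparsity (χ b c) =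
      Fintype.card V * ∑ a, ∑ b, sparsity (χ a b) := by
    simp only [Finset.sum_const, Finset.card_univ, nsmul_eq_mul]
  simp only [Finset.sum_add_distrib, Finset.sum_sub_distrib, ← Finset.mul_sum,
    sum_cherrySum χ hχ, hlast, Finset.sum_const, Finset.card_univ, nsmul_eq_mul] at hsum
  have hflow : 0 ≤ ∑ a, (∑ b, flow (χ a b)) ^ 2 := Finset.sum_nonneg fun _ _ => sq_nonneg _
  have hsp : 0 ≤ ∑ a, (∑ b, sparsity (χ a b)) ^ 2 := Finset.sum_nonneg fun _ _ => sq_nonneg _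
  linarith

end ColorSums

namespace OrientedGraph

section Counting

variable {V : Type} [Fintype V] [DecidableEq V] (G : OrientedGraph V)

/-- The colour of an ordered pair: `0` if it is non-adjacent, `1` for an outgoing edge and `2` for
an incoming edge. -/
noncomputable def color (u v : V) : Fin 3 :=
  if G.adj u v then 1 else if G.adj v u then 2 else 0

theorem color_swap (u v : V) : G.color v u = -G.color u v := by
  have h := G.asymm u v
  unfold color
  by_cases h₁ : G.adj u v <;> by_cases h₂ : G.adj v u <;> simp_all <;> decide

theorem color_eq_one_iff {u v : V} : G.color u v = 1 ↔ G.adj u v := by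
  unfold color
  split_ifs <;> simp_all

theorem color_eq_two_iff {u v : V} : G.color u v = 2 ↔ G.adj v u := by
  rw [← G.color_eq_one_iff, G.color_swap u v]
  generalize G.color u v = x
  revert x
  decide

theorem color_eq_zero_iff {u v : V} : G.color u v = 0 ↔ ¬G.adj u v ∧ ¬G.adj v u := by
  rw [← G.color_eq_one_iff, ← G.color_eq_two_iff]
  generalize G.color u v = x
  revert x
  decide

theorem not_adj_self (v : V) : ¬G.adj v v := fun h => G.asymm v v h h

/-- The distinct triples of vertices that form a transitive triangle or an independent triple. -/
noncomputable def monotoneTriples : Finset (V × V × V) :=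
  Finset.univ.filter fun p => p.1 ≠ p.2.1 ∧ p.1 ≠ p.2.2 ∧ p.2.1 ≠ p.2.2 ∧
    monotoneTriple (G.color p.1 p.2.1) (G.color p.1 p.2.2) (G.color p.2.1 p.2.2) = 1

theorem isTransTriangle_or_isIndep {a b c : V}
    (h : monotoneTriple (G.color a b) (G.color a c) (G.color b c) = 1) :
    G.isTransTriangle {a, b, c} ∨ G.isIndep {a, b, c} := by
  have cases : ∀ x y z : Fin 3, monotoneTriple x y z = 1 →
      (x = 0 ∧ y = 0 ∧ z = 0) ∨ (x = 1 ∧ y = 1 ∧ z = 1) ∨ (x = 1 ∧ y = 1 ∧ z = 2) ∨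
      (x = 2 ∧ y = 1 ∧ z = 1) ∨ (x = 2 ∧ y = 2 ∧ z = 1) ∨ (x = 1 ∧ y = 2 ∧ z = 2) ∨
      (x = 2 ∧ y = 2 ∧ z = 2) := by decide
  rcases cases _ _ _ h with h | h | h | h | h | h | h <;>
    simp only [color_eq_one_iff, color_eq_two_iff, color_eq_zero_iff] at h
  · right
    have := G.not_adj_self
    simp only [isIndep, Finset.mem_insert, Finset.mem_singleton]
    rintro x (rfl | rfl | rfl) y (rfl | rfl | rfl) <;> tauto
  · exact .inl ⟨a, b, c, rfl, h.1, h.2.2, h.2.1⟩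
  · exact .inl ⟨a, c, b, by grind, h.2.1, h.2.2, h.1⟩
  · exact .inl ⟨b, a, c, by grind, h.1, h.2.1, h.2.2⟩
  · exact .inl ⟨b, c, a, by grind, h.2.2, h.2.1, h.1⟩
  · exact .inl ⟨c, a, b, by grind, h.2.1, h.1, h.2.2⟩
  · exact .inl ⟨c, b, a, by grind, h.2.2, h.1, h.2.1⟩

theorem card_monotoneTriples_le : G.monotoneTriples.card ≤ 6 * (G.T3 + G.I3) := by
  set t := (Finset.univ.powersetCard 3 : Finset (Finset V)).filter
    fun s => G.isTransTriangle s ∨ G.isIndep s with ht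
  have hcard : t.card ≤ G.T3 + G.I3 := by
    rw [ht, Finset.filter_or]
    exact Finset.card_union_le _ _
  refine le_trans (Finset.card_le_mul_card_image_of_maps_to (t := t)
    (f := fun p : V × V × V => ({p.1, p.2.1, p.2.2} : Finset V)) ?_ 6 ?_)
    (Nat.mul_le_mul_left 6 hcard)
  · rintro ⟨a, b, c⟩ hp
    simp only [monotoneTriples, Finset.mem_filter, Finset.mem_univ, true_and] at hp
    simp only [ht, Finset.mem_filter, Finset.mem_powersetCard_univ]
    exact ⟨Finset.card_eq_three.2 ⟨a, b, c, hp.1, hp.2.1, hp.2.2.1, rfl⟩,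
      G.isTransTriangle_or_isIndep hp.2.2.2⟩
  · intro s hs
    obtain ⟨x, y, z, hxy, hxz, hyz, rfl⟩ := Finset.card_eq_three.1
      (Finset.mem_powersetCard_univ.1 (Finset.mem_filter.1 hs).1)
    refine le_trans (Finset.card_le_card (t := {(x, y, z), (x, z, y), (y, x, z), (y, z, x),
      (z, x, y), (z, y, x)}) ?_) Finset.card_le_six
    rintro ⟨a, b, c⟩ hp
    simp only [monotoneTriples, Finset.mem_filter, Finset.mem_univ, true_and] at hp
    obtain ⟨⟨hab, hac, hbc, -⟩, he⟩ := hp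
    have ha : a ∈ ({x, y, z} : Finset V) := he ▸ by simp
    have hb : b ∈ ({x, y, z} : Finset V) := he ▸ by simp
    have hc : c ∈ ({x, y, z} : Finset V) := he ▸ by simp
    simp only [Finset.mem_insert, Finset.mem_singleton] at ha hb hc
    clear he hs hcard ht
    rcases ha with rfl | rfl | rfl <;> rcases hb with rfl | rfl | rfl <;>
      rcases hc with rfl | rfl | rfl <;> simp_all

theorem sum_monotoneTriple_le :
    ∑ a, ∑ b, ∑ c, monotoneTriple (G.color a b) (G.color a c) (G.color b c) ≤
      6 * ((G.T3 : ℤ) + G.I3) + 3 * (Fintype.card V : ℤ) ^ 2 := by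
  have hpt : ∀ a b c, monotoneTriple (G.color a b) (G.color a c) (G.color b c) ≤
      (if (a, b, c) ∈ G.monotoneTriples then 1 else 0) + (if a = b then 1 else 0) +
        (if a = c then 1 else 0) + (if b = c then 1 else 0) := by
    intro a b c
    have h01 : ∀ x y z : Fin 3, monotoneTriple x y z = 0 ∨ monotoneTriple x y z = 1 := by decide
    simp only [monotoneTriples, Finset.mem_filter, Finset.mem_univ, true_and]
    have := h01 (G.color a b) (G.color a c) (G.color b c)
    grind
  have hsum := Finset.sum_le_sum fun a (_ : a ∈ Finset.univ) =>
    Finset.sum_le_sum fun b (_ : b ∈ Finset.univ) =>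
    Finset.sum_le_sum fun c (_ : c ∈ Finset.univ) => hpt a b c
  have hT : ∑ a, ∑ b, ∑ c, (if (a, b, c) ∈ G.monotoneTriples then (1 : ℤ) else 0) =
      G.monotoneTriples.card := by
    have h : (G.monotoneTriples.card : ℤ) = ∑ p, if p ∈ G.monotoneTriples then 1 else 0 := by simp
    simp only [h, Fintype.sum_prod_type]
  have hcard : (G.monotoneTriples.card : ℤ) ≤ 6 * ((G.T3 : ℤ) + G.I3) := by
    exact_mod_cast G.card_monotoneTriples_le
  simp only [Finset.sum_add_distrib, hT, Finset.sum_ite_eq, Finset.mem_univ, if_true,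
    Finset.sum_const, Finset.card_univ, nsmul_eq_mul, mul_one, mul_ite,
    mul_zero] at hsum
  nlinarith

theorem edgeCount_eq_sum : (G.edgeCount : ℤ) = ∑ a, ∑ b, if G.adj a b then 1 else 0 := by
  simp only [edgeCount, outDeg, Finset.card_filter]
  push_cast
  rfl

theorem sum_sparsity :
    ∑ a, ∑ b, sparsity (G.color a b) = 2 * (Fintype.card V : ℤ) ^ 2 - 6 * G.edgeCount := by
  have hpt : ∀ a b, sparsity (G.color a b) =
      2 - 3 * (if G.adj a b then 1 else 0) - 3 * (if G.adj b a then 1 else 0) := by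
    intro a b
    have := G.asymm a b
    unfold color
    by_cases h₁ : G.adj a b <;> by_cases h₂ : G.adj b a <;> simp_all <;> decide
  have hswap : ∑ a, ∑ b, (if G.adj b a then (1 : ℤ) else 0) = G.edgeCount := by
    rw [Finset.sum_comm, edgeCount_eq_sum]
  simp only [hpt, Finset.sum_sub_distrib, ← Finset.mul_sum, hswap, ← edgeCount_eq_sum,
    Finset.sum_const, Finset.card_univ, nsmul_eq_mul]
  ring

end Counting

theorem sum_card_section_right {V : Type} [Fintype V] [DecidableEq V] (M : Finset (V × V)) :
    ∑ u, (Finset.univ.filter fun w => (u, w) ∈ M).card = M.card := by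
  simp only [Finset.card_filter, ← Fintype.sum_prod_type (f := fun p => if p ∈ M then 1 else 0)]
  simp

theorem sum_card_section_left {V : Type} [Fintype V] [DecidableEq V] (M : Finset (V × V)) :
    ∑ u, (Finset.univ.filter fun w => (w, u) ∈ M).card = M.card := by
  rw [← sum_card_section_right M]
  simp only [Finset.card_filter]
  exact Finset.sum_comm

section Stability

variable {V : Type} [Fintype V] [DecidableEq V] (G : OrientedGraph V)

/-- The ordered pairs on which `G` differs from the blow-up of a cyclic triangle whose parts are
the fibres of `cls`. -/
noncomputable def misfits (cls : V → ZMod 3) : Finset (V × V) :=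
  Finset.univ.filter fun p => ¬(G.adj p.1 p.2 ↔ cls p.2 = cls p.1 + 1)

theorem card_misfits_color_le (v : V) :
    ((G.misfits (G.color v)).card : ℤ) ≤
      ∑ b, ∑ c, deviant (G.color v b) (G.color v c) (G.color b c) := by
  have hpt : ∀ b c, (if (b, c) ∈ G.misfits (G.color v) then 1 else 0) ≤
      deviant (G.color v b) (G.color v c) (G.color b c) := by
    intro b c
    simp only [misfits, Finset.mem_filter, Finset.mem_univ, true_and, ← G.color_eq_one_iff]
    have key : ∀ x y z : Fin 3, (if ¬(z = 1 ↔ y = x + 1) then 1 else 0) ≤ deviant x y z := by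
      decide
    convert key (G.color v b) (G.color v c) (G.color b c)
    exact Iff.rfl
  calc ((G.misfits (G.color v)).card : ℤ)
      = ∑ p, if p ∈ G.misfits (G.color v) then 1 else 0 := by simp
    _ = ∑ b, ∑ c, if (b, c) ∈ G.misfits (G.color v) then 1 else 0 := Fintype.sum_prod_type _
    _ ≤ _ := Finset.sum_le_sum fun b _ => Finset.sum_le_sum fun c _ => hpt b c

/-- Few transitive triangles and independent triples force a graph close to the blow-up of a cyclic
triangle, with nearly `n² / 3` edges. -/
theorem exists_misfits_le [Nonempty V] {s : ℝ} (hs : 0 < s) (hs₁ : s ≤ 1)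
    (hV : 216 ≤ s ^ 2 * Fintype.card V)
    (hG : 6 * ((G.T3 : ℝ) + G.I3) ≤ (1 / 9 + s ^ 2 / 72) * (Fintype.card V : ℝ) ^ 3) :
    (∃ cls : V → ZMod 3, ((G.misfits cls).card : ℝ) ≤ 4 * s * (Fintype.card V : ℝ) ^ 2) ∧
      (1 / 3 - s / 6) * (Fintype.card V : ℝ) ^ 2 ≤ G.edgeCount := by
  obtain ⟨H, hH⟩ : ∃ H : ℤ, H =
    ∑ a, ∑ b, ∑ c, monotoneTriple (G.color a b) (G.color a c) (G.color b c) := ⟨_, rfl⟩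
  obtain ⟨S, hS⟩ : ∃ S : ℤ, S = ∑ a, ∑ b, sparsity (G.color a b) := ⟨_, rfl⟩
  obtain ⟨D, hD⟩ : ∃ D : ℤ, D =
    ∑ a, ∑ b, ∑ c, deviant (G.color a b) (G.color a c) (G.color b c) := ⟨_, rfl⟩
  have hHle : H ≤ 6 * ((G.T3 : ℤ) + G.I3) + 3 * (Fintype.card V : ℤ) ^ 2 :=
    hH ▸ G.sum_monotoneTriple_le
  have hSsq : S ^ 2 + 4 * (Fintype.card V : ℤ) ^ 4 ≤ 36 * Fintype.card V * H := by
    have h := (sq_sum_le_card_mul_sum_sq (s := (Finset.univ : Finset V))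
      (f := fun a => ∑ b, sparsity (G.color a b))).trans
      (mul_le_mul_of_nonneg_left (sum_sq_sparsity_le G.color G.color_swap) (Nat.cast_nonneg _))
    rw [Finset.card_univ, ← hH, ← hS] at h
    linarith
  have hDle : 9 * D + 15 * (Fintype.card V : ℤ) ^ 3 ≤ 135 * H + 24 * (Fintype.card V * S) := by
    have h := sum_deviant_le G.color G.color_swap
    rw [← hH, ← hS, ← hD] at h
    linarith
  have hSe : S + 6 * G.edgeCount = 2 * (Fintype.card V : ℤ) ^ 2 := by
    rw [hS, G.sum_sparsity, sub_add_cancel]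
  rify at hHle hSsq hDle hSe
  have hsum : ∑ a, ((∑ b, ∑ c, deviant (G.color a b) (G.color a c) (G.color b c) : ℤ) : ℝ) =
      D := by
    rw [← Int.cast_sum, hD]
  have hn₀ : 0 < (Fintype.card V : ℝ) := by exact_mod_cast Fintype.card_pos (α := V)
  obtain ⟨n, hn⟩ : ∃ n : ℝ, n = Fintype.card V := ⟨_, rfl⟩
  rw [← hn] at hV hG hHle hSsq hDle hSe hn₀ ⊢
  have hdef : 36 * (H : ℝ) - 4 * n ^ 3 ≤ s ^ 2 * n ^ 3 := by
    have := mul_le_mul_of_nonneg_right hV (sq_nonneg n)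
    nlinarith
  have hSle : (S : ℝ) ≤ s * n ^ 2 := by
    refine (le_abs_self _).trans (abs_le_of_sq_le_sq ?_ (by positivity))
    calc (S : ℝ) ^ 2 ≤ n * (36 * H - 4 * n ^ 3) := by linarith
      _ ≤ n * (s ^ 2 * n ^ 3) := mul_le_mul_of_nonneg_left hdef hn₀.le
      _ = (s * n ^ 2) ^ 2 := by ring
  have hDs : (D : ℝ) ≤ n * (4 * s * n ^ 2) := by
    have h₁ : n * S ≤ n * (s * n ^ 2) := mul_le_mul_of_nonneg_left hSle hn₀.le
    have h₂ : s ^ 2 * n ^ 3 ≤ s * n ^ 3 :=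
      mul_le_mul_of_nonneg_right (by nlinarith) (by positivity)
    have h₃ : 0 ≤ s * n ^ 3 := by positivity
    nlinarith
  refine ⟨?_, by linarith⟩
  have hle : ∑ a, ((∑ b, ∑ c, deviant (G.color a b) (G.color a c) (G.color b c) : ℤ) : ℝ) ≤
      ∑ _a : V, 4 * s * n ^ 2 := by
    rwa [hsum, Finset.sum_const, Finset.card_univ, nsmul_eq_mul, ← hn]
  obtain ⟨v, -, hv⟩ := Finset.exists_le_of_sum_le Finset.univ_nonempty hle
  exact ⟨G.color v, le_trans (by exact_mod_cast G.card_misfits_color_le v) hv⟩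

/-- The edges of `G` between consecutive fibres of `cls`. -/
def cyclicPart (cls : V → ZMod 3) : OrientedGraph V where
  adj u v := G.adj u v ∧ cls v = cls u + 1
  asymm u v h h' := G.asymm u v h.1 h'.1

/-- The fibre of `cls` over `i`. -/
noncomputable def part (cls : V → ZMod 3) (i : ZMod 3) : Finset V :=
  Finset.univ.filter fun v => cls v = i

theorem edgeCount_eq_card :
    G.edgeCount = ((Finset.univ : Finset (V × V)).filter fun p => G.adj p.1 p.2).card := by
  simp only [edgeCount, outDeg, Finset.card_filter, Fintype.sum_prod_type]

variable (cls : V → ZMod 3)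

theorem card_deleted_le :
    ((Finset.univ ×ˢ Finset.univ : Finset (V × V)).filter
      (fun p => G.adj p.1 p.2 ∧ ¬(G.cyclicPart cls).adj p.1 p.2)).card ≤ (G.misfits cls).card := by
  refine Finset.card_le_card fun p hp => ?_
  simp only [Finset.mem_filter, misfits, Finset.mem_univ, true_and] at hp ⊢
  simp only [cyclicPart] at hp
  tauto

theorem edgeCount_le_add_card_misfits :
    G.edgeCount ≤ (G.cyclicPart cls).edgeCount + (G.misfits cls).card := by
  rw [edgeCount_eq_card, edgeCount_eq_card]
  refine (Finset.card_le_card fun p hp => ?_).trans (Finset.card_union_le _ _)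
  simp only [Finset.mem_union, Finset.mem_filter, misfits, Finset.mem_univ, true_and] at hp ⊢
  simp only [cyclicPart]
  tauto

theorem eCount_cyclicPart {i j : ZMod 3} (hij : j ≠ i + 1) :
    (G.cyclicPart cls).eCount (part cls i) (part cls j) = 0 := by
  refine Finset.sum_eq_zero fun u hu => Finset.card_eq_zero.2 (Finset.filter_eq_empty_iff.2 ?_)
  intro w hw h
  simp only [part, Finset.mem_filter, Finset.mem_univ, true_and] at hu hw
  exact hij (hw ▸ hu ▸ h.2)

theorem sum_card_part {V : Type} [Fintype V] (cls : V → ZMod 3) :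
    (part cls 0).card + (part cls 1).card + (part cls 2).card = Fintype.card V := by
  have h := Finset.card_eq_sum_card_fiberwise (s := (Finset.univ : Finset V)) (t := Finset.univ)
    (f := cls) fun _ _ => Finset.mem_univ _
  rw [← Finset.card_univ, h]
  exact (Fin.sum_univ_three fun i : Fin 3 => (part cls i).card).symm

theorem edgeCount_cyclicPart_le : (G.cyclicPart cls).edgeCount ≤
    (part cls 0).card * (part cls 1).card + (part cls 1).card * (part cls 2).card +
      (part cls 2).card * (part cls 0).card := by
  rw [edgeCount_eq_card]
  have hsub : (Finset.univ.filter fun p : V × V => (G.cyclicPart cls).adj p.1 p.2) ⊆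
      (part cls 0 ×ˢ part cls 1 ∪ part cls 1 ×ˢ part cls 2) ∪ part cls 2 ×ˢ part cls 0 := by
    intro p hp
    simp only [Finset.mem_union, Finset.mem_product, Finset.mem_filter, part, Finset.mem_univ,
      true_and] at hp ⊢
    simp only [cyclicPart] at hp
    rw [hp.2]
    generalize cls p.1 = x
    revert x
    decide
  refine (Finset.card_le_card hsub).trans ((Finset.card_union_le _ _).trans ?_)
  simp only [Finset.card_product]
  gcongr
  refine (Finset.card_union_le _ _).trans_eq ?_
  simp only [Finset.card_product]

/-- If `G` has nearly `n² / 3` edges then the parts are nearly balanced. -/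
theorem sq_card_part_sub_le {γ : ℝ} (i : ZMod 3)
    (hG : (1 / 3 - γ) * (Fintype.card V : ℝ) ^ 2 ≤ (G.cyclicPart cls).edgeCount) :
    (((part cls i).card : ℝ) - Fintype.card V / 3) ^ 2 ≤ 2 * γ * (Fintype.card V : ℝ) ^ 2 := by
  have h₁ : (((part cls 0).card : ℝ) + (part cls 1).card + (part cls 2).card) =
      Fintype.card V := by exact_mod_cast sum_card_part cls
  have h₂ : ((G.cyclicPart cls).edgeCount : ℝ) ≤
      (part cls 0).card * (part cls 1).card + (part cls 1).card * (part cls 2).card +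
      (part cls 2).card * (part cls 0).card := by exact_mod_cast G.edgeCount_cyclicPart_le cls
  have key : ∀ x y z N : ℝ, x + y + z = N → (1 / 3 - γ) * N ^ 2 ≤ x * y + y * z + z * x →
      (x - N / 3) ^ 2 ≤ 2 * γ * N ^ 2 := by
    rintro x y z N rfl h
    nlinarith [sq_nonneg (y - (x + y + z) / 3), sq_nonneg (z - (x + y + z) / 3)]
  have h := hG.trans h₂
  fin_cases i
  · exact key _ _ _ _ h₁ h
  · exact key (part cls 1).card (part cls 2).card (part cls 0).card _ (by linarith) (by linarith)
  · exact key (part cls 2).card (part cls 0).card (part cls 1).card _ (by linarith) (by linarith)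

theorem card_part_le_outDegIn_add {i : ZMod 3} {u : V} (hu : u ∈ part cls i) :
    (part cls (i + 1)).card ≤ (G.cyclicPart cls).outDegIn u (part cls (i + 1)) +
      (Finset.univ.filter fun w => (u, w) ∈ G.misfits cls).card := by
  refine (Finset.card_le_card fun w hw => ?_).trans (Finset.card_union_le _ _)
  simp only [part, misfits, Finset.mem_union, Finset.mem_filter, Finset.mem_univ,
    true_and] at *
  simp only [cyclicPart]
  subst hu
  tauto

theorem card_part_le_inDegIn_add {i : ZMod 3} {u : V} (hu : u ∈ part cls i) :
    (part cls (i - 1)).card ≤ (G.cyclicPart cls).inDegIn u (part cls (i - 1)) +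
      (Finset.univ.filter fun w => (w, u) ∈ G.misfits cls).card := by
  refine (Finset.card_le_card fun w hw => ?_).trans (Finset.card_union_le _ _)
  simp only [part, misfits, Finset.mem_union, Finset.mem_filter, Finset.mem_univ,
    true_and] at *
  simp only [cyclicPart]
  have : cls u = cls w + 1 := by rw [hu, hw, sub_add_cancel]
  tauto

end Stability

/-- Few vertices have a large section of a small set of pairs. -/
theorem card_le_of_le_section {V : Type} [Fintype V] {f : V → ℕ} {m : ℕ} {ε N : ℝ} (hε : 0 < ε)
    (hε₁ : ε ≤ 1) (hN : 0 < N) (hf : ∑ u, f u = m) (hm : (m : ℝ) ≤ 1 / 12 * ε ^ 6 * N ^ 2)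
    {X : Finset V} (hX : ∀ u ∈ X, 4 * ε * N ≤ f u) : (X.card : ℝ) ≤ 15 / 2 * ε * N := by
  have h₁ : X.card * (4 * ε * N) ≤ m := by
    rw [← nsmul_eq_mul, ← hf, Nat.cast_sum]
    exact (Finset.card_nsmul_le_sum _ _ _ hX).trans
      (Finset.sum_le_univ_sum_of_nonneg fun _ => Nat.cast_nonneg _)
  have h₂ : ε ^ 6 ≤ ε ^ 2 := pow_le_pow_of_le_one hε.le hε₁ (by norm_num)
  refine le_of_mul_le_mul_right ?_ (show 0 < 4 * ε * N by positivity)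
  have h₃ : ε ^ 6 * N ^ 2 ≤ ε ^ 2 * N ^ 2 := mul_le_mul_of_nonneg_right h₂ (sq_nonneg N)
  nlinarith [show 0 ≤ ε ^ 2 * N ^ 2 by positivity]

theorem six_mul_T3_add_I3_le {n : ℕ} (hn : 3 ≤ n) (G : OrientedGraph (Fin n)) {c : ℝ}
    (hG : G.tDens + G.iDens ≤ c) : 6 * ((G.T3 : ℝ) + G.I3) ≤ c * (n : ℝ) ^ 3 := by
  have hpos : 0 < (n.choose 3 : ℝ) := by exact_mod_cast Nat.choose_pos hn
  have hle : 6 * (n.choose 3 : ℝ) ≤ (n : ℝ) ^ 3 := by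
    have h := Nat.choose_le_pow_div (α := ℝ) 3 n
    rw [le_div_iff₀ (by positivity)] at h
    norm_num [Nat.factorial] at h
    linarith
  have hc : 0 ≤ c := le_trans (by unfold tDens iDens; positivity) hG
  rw [tDens, iDens, Fintype.card_fin, ← add_div, div_le_iff₀ hpos] at hG
  calc 6 * ((G.T3 : ℝ) + G.I3) ≤ c * (6 * n.choose 3) := by linarith
    _ ≤ c * (n : ℝ) ^ 3 := mul_le_mul_of_nonneg_left hle hc

end OrientedGraph

/-- Stability with structure: for every 0 < ε < 1/360 there are n₀ and δ > 0
such that if `G` is an oriented graph on `n ≥ n₀` vertices with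
`t(G) + i(G) ≤ 1/9 + δ`, then the vertex set is a disjoint union
`B ⊔ V₀ ⊔ V₁ ⊔ V₂` and there is a graph `G̃` obtained from `G` by deleting at
most `(1/12)ε⁶n²` edges satisfying properties (1)–(3) (indices mod 3). -/
theorem stmt_16 (ε : ℝ) (hε : 0 < ε) (hε' : ε < 1 / 360) :
    ∃ (n₀ : ℕ) (δ : ℝ), 0 < n₀ ∧ 0 < δ ∧
      ∀ n : ℕ, n₀ ≤ n → ∀ G : OrientedGraph (Fin n),
        G.tDens + G.iDens ≤ 1 / 9 + δ →
        ∃ (B : Finset (Fin n)) (Vf : ZMod 3 → Finset (Fin n))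
          (Gt : OrientedGraph (Fin n)),
          -- V is the disjoint union of B, V₀, V₁, V₂
          (∀ i j : ZMod 3, i ≠ j → Disjoint (Vf i) (Vf j)) ∧
          (∀ i : ZMod 3, Disjoint B (Vf i)) ∧
          (∀ v : Fin n, v ∈ B ∨ ∃ i : ZMod 3, v ∈ Vf i) ∧
          -- G̃ is obtained from G by deleting at most (1/12)ε⁶n² edges
          (∀ u v : Fin n, Gt.adj u v → G.adj u v) ∧
          ((((Finset.univ ×ˢ Finset.univ : Finset (Fin n × Fin n)).filter
              (fun p => G.adj p.1 p.2 ∧ ¬ Gt.adj p.1 p.2)).card : ℝ)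
            ≤ (1 / 12) * ε ^ 6 * (n : ℝ) ^ 2) ∧
          -- (1)
          ((1 / 3) * (n : ℝ) ^ 2 - (1 / 15) * ε * (n : ℝ) ^ 2 ≤ (Gt.edgeCount : ℝ)) ∧
          ((Gt.eCount (Vf 1) (Vf 0) + Gt.eCount (Vf 2) (Vf 1) + Gt.eCount (Vf 0) (Vf 2) : ℝ)
            ≤ 12 * ε * (n : ℝ) ^ 2) ∧
          -- (2)
          (∀ i : ZMod 3, ∀ x ∈ Vf i, ∀ y ∈ Vf i, ¬ Gt.adj x y) ∧
          (∀ i : ZMod 3,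
            (1 / 3 - 15 * ε ^ 2) * (n : ℝ) ≤ ((Vf i).card : ℝ) ∧
            ((Vf i).card : ℝ) ≤ (1 / 3 + 5 * ε ^ 2) * (n : ℝ)) ∧
          -- (3)
          ((B.card : ℝ) ≤ 5 * ε ^ 2 * (n : ℝ)) ∧
          (∀ i : ZMod 3,
            ((((Vf i).filter (fun u =>
                (Gt.outDegIn u (Vf (i + 1)) : ℝ) < (1 / 3 - 4 * ε - 15 * ε ^ 2) * (n : ℝ))).card : ℝ)
                ≤ (15 / 2) * ε * (n : ℝ)) ∧
            ((((Vf i).filter (fun u =>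
                (Gt.inDegIn u (Vf (i - 1)) : ℝ) < (1 / 3 - 4 * ε - 15 * ε ^ 2) * (n : ℝ))).card : ℝ)
                ≤ (15 / 2) * ε * (n : ℝ))) := by
  set s : ℝ := ε ^ 6 / 48 with hs
  have hs₀ : 0 < s := by positivity
  have hpow : ∀ k : ℕ, k ≤ 6 → ε ^ 6 ≤ ε ^ k := fun k hk =>
    pow_le_pow_of_le_one hε.le (by linarith) hk
  have hs₁ : s ≤ 1 := by linarith [hpow 0 (by norm_num), pow_zero ε]
  refine ⟨⌈216 / s ^ 2⌉₊ + 3, s ^ 2 / 72, by positivity, by positivity, fun n hn G hG => ?_⟩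
  have hn₃ : 3 ≤ n := by omega
  have : Nonempty (Fin n) := ⟨⟨0, by omega⟩⟩
  have hN : 0 < (n : ℝ) := by exact_mod_cast (by omega : 0 < n)
  have hV : 216 ≤ s ^ 2 * n := by
    rw [mul_comm, ← div_le_iff₀ (by positivity)]
    exact Nat.ceil_le.1 (by omega)
  obtain ⟨⟨cls, hcls⟩, hedge⟩ := G.exists_misfits_le hs₀ hs₁ (by rwa [Fintype.card_fin])
    (by rw [Fintype.card_fin]; exact G.six_mul_T3_add_I3_le hn₃ hG)
  rw [Fintype.card_fin] at hcls hedge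
  replace hcls : ((G.misfits cls).card : ℝ) ≤ 1 / 12 * ε ^ 6 * (n : ℝ) ^ 2 :=
    hcls.trans_eq (by rw [hs]; ring)
  have hkeep : (1 / 3 - 25 / 288 * ε ^ 6) * (n : ℝ) ^ 2 ≤ (G.cyclicPart cls).edgeCount := by
    have h : (G.edgeCount : ℝ) ≤ (G.cyclicPart cls).edgeCount + (G.misfits cls).card := by
      exact_mod_cast G.edgeCount_le_add_card_misfits cls
    rw [hs] at hedge
    linarith
  have hsize : ∀ i, |((OrientedGraph.part cls i).card : ℝ) - n / 3| ≤ 5 * ε ^ 2 * n := by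
    intro i
    have h := G.sq_card_part_sub_le cls i (by rwa [Fintype.card_fin])
    rw [Fintype.card_fin] at h
    refine abs_le_of_sq_le_sq (h.trans ?_) (by positivity)
    rw [mul_pow]
    refine mul_le_mul_of_nonneg_right ?_ (by positivity)
    linarith [hpow 4 (by norm_num), show 0 ≤ ε ^ 4 by positivity]
  have hε₂ : 0 ≤ ε ^ 2 * n := by positivity
  refine ⟨∅, OrientedGraph.part cls, G.cyclicPart cls, ?_, fun _ => Finset.disjoint_empty_left _,
    fun v => Or.inr ⟨cls v, by simp [OrientedGraph.part]⟩, fun u v h => h.1,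
    le_trans (by exact_mod_cast G.card_deleted_le cls) hcls, ?_, ?_, ?_, fun i => ?_,
    by simpa using by positivity, fun i => ⟨?_, ?_⟩⟩
  · intro i j hij
    rw [Finset.disjoint_left]
    simp only [OrientedGraph.part, Finset.mem_filter, Finset.mem_univ, true_and]
    rintro v rfl
    exact hij
  · refine le_trans ?_ hkeep
    rw [← sub_mul]
    refine mul_le_mul_of_nonneg_right ?_ (by positivity)
    nlinarith [hpow 2 (by norm_num)]
  · rw [G.eCount_cyclicPart cls (by decide), G.eCount_cyclicPart cls (by decide),
      G.eCount_cyclicPart cls (by decide)]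
    simp only [Nat.cast_zero, add_zero]
    positivity
  · simp only [OrientedGraph.part, Finset.mem_filter, Finset.mem_univ, true_and]
    rintro i x rfl y hy ⟨-, h⟩
    rw [hy, left_eq_add] at h
    exact absurd h (by decide)
  · have h := abs_le.1 (hsize i)
    constructor <;> linarith
  · refine OrientedGraph.card_le_of_le_section hε (by linarith) hN
      (OrientedGraph.sum_card_section_right (G.misfits cls)) hcls fun u hu => ?_
    rw [Finset.mem_filter] at hu
    have h := G.card_part_le_outDegIn_add cls hu.1
    rify at h
    linarith [(abs_le.1 (hsize (i + 1))).1]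
  · refine OrientedGraph.card_le_of_le_section hε (by linarith) hN
      (OrientedGraph.sum_card_section_left (G.misfits cls)) hcls fun u hu => ?_
    rw [Finset.mem_filter] at hu
    have h := G.card_part_le_inDegIn_add cls hu.1
    rify at h
    linarith [(abs_le.1 (hsize (i - 1))).1]
end

section
/- There exists ε₀ > 0 such that for every 0 < ε < ε₀ there exists a positive integer n₀ for which the following holds for all n ≥ n₀. Let G be an oriented graph on an n-element vertex set V that minimizes T₃(G) + I₃(G) among all oriented graphs on n vertices, and let V = V₀ ⊔ V₁ ⊔ V₂ ⊔ B be a partition satisfying (indices mod 3): (1) (1/3 − 20ε)·n ≤ |V_i| ≤ (1/3 + 48ε)·n for every i; (2) for every i and every u ∈ V_i, d⁺(u, V_{i+1}) ≥ (1/3 − ε^{1/3})·n and d⁻(u, V_{i−1}) ≥ (1/3 − ε^{1/3})·n; (3) |B| ≤ 48ε·n; (4) for every u ∈ B and every i, d⁺(u, V_{i+1}) < (1/3 − ε^{1/3})·n or d⁻(u, V_{i−1}) < (1/3 − ε^{1/3})·n. Then: (a) V_i is independent in G for every i; (b) there is no edge directed from a vertex of V_i to a vertex of V_{i−1} for any i;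 and (c) B = ∅. -/
open scoped Classical

theorem cyclic_weights_stability_of_min {a0 a1 a2 b0 b1 b2 η t : ℝ} (ha0 : 0 ≤ a0)
    (ha1 : 0 ≤ a1) (ha2 : 0 ≤ a2) (hb0 : 0 ≤ b0) (hb1 : 0 ≤ b1) (hb2 : 0 ≤ b2)
    (hs0 : a0 + b0 ≤ 3 / 2) (hs1 : a1 + b1 ≤ 3 / 2) (hs2 : a2 + b2 ≤ 3 / 2)
    (h01 : a0 + b0 ≤ a1 + b1) (h02 : a0 + b0 ≤ a2 + b2)
    (ht : 0 ≤ t) (ht' : t ≤ 1 / 10) (hη : 100 * η ≤ t ^ 2)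
    (h : (1 - a0 - b0) ^ 2 / 2 + (1 - a1 - b1) ^ 2 / 2 + (1 - a2 - b2) ^ 2 / 2 +
      (a0 * a1 + b0 * b1 + b0 * a1) + (a1 * a2 + b1 * b2 + b1 * a2) +
      (a2 * a0 + b2 * b0 + b2 * a0) ≤ 1 / 2 + η) :
    1 - 2 * t ≤ a1 ∧ 1 - 2 * t ≤ b2 := by
  have hmax : a0 * b1 + a1 * b2 + a2 * b0 ≤ (a1 + b1) * (a2 + b2) := by
    rcases le_total a2 b1 with hab | hab
    · linarith [mul_le_mul_of_nonneg_left h02 hb1, mul_le_mul_of_nonneg_right hab hb0,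
        mul_nonneg ha1 ha2]
    · linarith [mul_le_mul_of_nonneg_left h01 ha2, mul_le_mul_of_nonneg_right hab ha0,
        mul_nonneg hb1 hb2]
  obtain ⟨s, hs⟩ : ∃ s, s = a0 + b0 := ⟨_, rfl⟩
  obtain ⟨x, hx⟩ : ∃ x, x = 1 - a1 - b1 := ⟨_, rfl⟩
  obtain ⟨y, hy⟩ : ∃ y, y = 1 - a2 - b2 := ⟨_, rfl⟩
  have hs_nn : 0 ≤ s := by linarith
  have hF : s * (1 + s / 2 - x - y) + (x ^ 2 + y ^ 2) / 2 ≤ η := by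
    subst hs hx hy
    linear_combination h + hmax
  have hx1 : x ≤ 1 := by linarith
  have hy1 : y ≤ 1 := by linarith
  have hs' : s ≤ 3 / 2 := by linarith
  have hsη : s ≤ 4 * η := by
    linarith [sq_nonneg ((x + y) / 2 - s), sq_nonneg (x - y),
      mul_nonneg hs_nn (sub_nonneg.2 hs')]
  have hxy : x ^ 2 + y ^ 2 ≤ 18 * η := by
    linarith [mul_nonneg hs_nn (by linarith : 0 ≤ 2 - x - y), mul_nonneg hs_nn hs_nn]
  have hη_nn : 0 ≤ η := by linarith [sq_nonneg x, sq_nonneg y]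
  have hxt : x ≤ t := abs_le_of_sq_le_sq' (by linarith [sq_nonneg y]) ht |>.2
  have hyt : y ≤ t := abs_le_of_sq_le_sq' (by linarith [sq_nonneg x]) ht |>.2
  have hη' : 1000 * η ≤ t := by linarith [mul_le_mul_of_nonneg_left ht' ht, sq t]
  have hsum : (x ^ 2 + y ^ 2) / 2 + s ^ 2 / 2 - s +
      ((a0 + b0) * (a1 + b1) + (a1 * a2 + b1 * (a2 + b2)) + (a2 + b2) * (a0 + b0)) -
      (a0 * b1 + a2 * b0) ≤ η := by
    subst hs hx hy
    linear_combination h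
  have hcross : a0 * b1 + a2 * b0 ≤ 3 / 2 * s := by
    linarith [mul_le_mul_of_nonneg_left (by linarith : b1 ≤ 3 / 2) ha0,
      mul_le_mul_of_nonneg_right (by linarith : a2 ≤ 3 / 2) hb0]
  have hprod : a1 * a2 + b1 * (a2 + b2) ≤ 11 * η := by
    linarith [mul_nonneg (add_nonneg ha0 hb0) (add_nonneg ha1 hb1),
      mul_nonneg (add_nonneg ha2 hb2) (add_nonneg ha0 hb0), sq_nonneg s, sq_nonneg x, sq_nonneg y]
  have hb1t : b1 ≤ t := by
    linarith [mul_nonneg ha1 ha2, mul_le_mul_of_nonneg_left (by linarith : 1 / 2 ≤ a2 + b2) hb1]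
  have ha2t : a2 ≤ t := by
    linarith [mul_nonneg hb1 hb2, mul_le_mul_of_nonneg_left (by linarith : 1 / 2 ≤ a1 + b1) ha2]
  constructor <;> linarith

theorem cyclic_weights_stability {a b : ZMod 3 → ℝ} {η t : ℝ} (ha : ∀ j, 0 ≤ a j)
    (hb : ∀ j, 0 ≤ b j) (hs : ∀ j, a j + b j ≤ 3 / 2) (ht : 0 ≤ t) (ht' : t ≤ 1 / 10)
    (hη : 100 * η ≤ t ^ 2)
    (hF : ∑ j, ((1 - a j - b j) ^ 2 / 2 +
      (a j * a (j + 1) + b j * b (j + 1) + b j * a (j + 1))) ≤ 1 / 2 + η) :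
    ∃ i, 1 - 2 * t ≤ a (i + 1) ∧ 1 - 2 * t ≤ b (i - 1) := by
  obtain ⟨i, hi⟩ := Finite.exists_min fun j => a j + b j
  refine ⟨i, ?_⟩
  rw [← Equiv.sum_comp (Equiv.addLeft i)] at hF
  have huniv : (Finset.univ : Finset (ZMod 3)) = {0, 1, 2} := by decide
  rw [huniv, Finset.sum_insert (by decide), Finset.sum_pair (by decide)] at hF
  simp only [Equiv.coe_addLeft] at hF
  have e1 : i + 1 + 1 = i - 1 := by clear hF hi; decide +revert
  have e2 : i + 2 = i - 1 := by clear hF hi; decide +revert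
  have e3 : i - 1 + 1 = i := by clear hF hi; decide +revert
  rw [add_zero, e1, e2, e3] at hF
  exact cyclic_weights_stability_of_min (ha i) (ha (i + 1)) (ha (i - 1)) (hb i) (hb (i + 1))
    (hb (i - 1)) (hs _) (hs _) (hs _) (hi _) (hi _) ht ht' hη (by linarith)

namespace OrientedGraph

variable {V : Type} [Fintype V] [DecidableEq V]

/-- A vertex set is bad if it spans a transitive triangle or is independent. -/
def isBad (G : OrientedGraph V) (s : Finset V) : Prop :=
  G.isTransTriangle s ∨ G.isIndep s

theorem T3_add_I3 (G : OrientedGraph V) :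
    G.T3 + G.I3 = ((Finset.univ.powersetCard 3 : Finset (Finset V)).filter G.isBad).card := by
  unfold T3 I3
  rw [← Finset.card_union_of_disjoint]
  · congr 1
    ext s
    simp only [Finset.mem_union, Finset.mem_filter, isBad]
    tauto
  rw [Finset.disjoint_filter]
  rintro s - ⟨x, y, z, rfl, hxy, -, -⟩ h
  exact h x (by simp) y (by simp) hxy

theorem isBad_congr {G G' : OrientedGraph V} {s : Finset V}
    (h : ∀ p ∈ s, ∀ q ∈ s, (G.adj p q ↔ G'.adj p q)) : G.isBad s ↔ G'.isBad s := by
  unfold isBad isTransTriangle isIndep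
  apply or_congr
  · constructor
    · rintro ⟨x, y, z, rfl, h1, h2, h3⟩
      exact ⟨x, y, z, rfl, (h _ (by simp) _ (by simp)).1 h1, (h _ (by simp) _ (by simp)).1 h2,
        (h _ (by simp) _ (by simp)).1 h3⟩
    · rintro ⟨x, y, z, rfl, h1, h2, h3⟩
      exact ⟨x, y, z, rfl, (h _ (by simp) _ (by simp)).2 h1, (h _ (by simp) _ (by simp)).2 h2,
        (h _ (by simp) _ (by simp)).2 h3⟩
  · exact forall₂_congr fun x hx => forall₂_congr fun y hy => not_congr (h x hx y hy)

theorem isBad_triple (G : OrientedGraph V) {a b c : V} (hab : a ≠ b) (hac : a ≠ c)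
    (hbc : b ≠ c) :
    G.isBad {a, b, c} ↔
      ((G.adj a b ∧ G.adj b c ∧ G.adj a c) ∨ (G.adj a c ∧ G.adj c b ∧ G.adj a b) ∨
       (G.adj b a ∧ G.adj a c ∧ G.adj b c) ∨ (G.adj b c ∧ G.adj c a ∧ G.adj b a) ∨
       (G.adj c a ∧ G.adj a b ∧ G.adj c b) ∨ (G.adj c b ∧ G.adj b a ∧ G.adj c a)) ∨
      (¬ G.adj a b ∧ ¬ G.adj b a ∧ ¬ G.adj a c ∧ ¬ G.adj c a ∧ ¬ G.adj b c ∧ ¬ G.adj c b) := by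
  have irr : ∀ v, ¬ G.adj v v := fun v h => G.asymm v v h h
  apply or_congr
  · constructor
    · rintro ⟨x, y, z, hs, h1, h2, h3⟩
      have ha : a ∈ ({x, y, z} : Finset V) := hs ▸ by simp
      have hb : b ∈ ({x, y, z} : Finset V) := hs ▸ by simp
      have hc : c ∈ ({x, y, z} : Finset V) := hs ▸ by simp
      simp only [Finset.mem_insert, Finset.mem_singleton] at ha hb hc
      rcases ha with rfl | rfl | rfl <;> rcases hb with rfl | rfl | rfl <;>
        rcases hc with rfl | rfl | rfl <;> simp_all
    · rintro (h | h | h | h | h | h)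
      · exact ⟨a, b, c, rfl, h⟩
      · exact ⟨a, c, b, by ext; simp; tauto, h⟩
      · exact ⟨b, a, c, by ext; simp; tauto, h⟩
      · exact ⟨b, c, a, by ext; simp; tauto, h⟩
      · exact ⟨c, a, b, by ext; simp; tauto, h⟩
      · exact ⟨c, b, a, by ext; simp; tauto, h⟩
  · simp only [isIndep, Finset.mem_insert, Finset.mem_singleton, forall_eq_or_imp, forall_eq]
    have := irr a; have := irr b; have := irr c
    tauto

theorem card_filter_isBad_le {G G' : OrientedGraph V} (hmin : G.T3 + G.I3 ≤ G'.T3 + G'.I3)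
    (P : Finset V → Prop)
    [DecidablePred P] (h : ∀ s, ¬ P s → (G.isBad s ↔ G'.isBad s)) :
    ((Finset.univ.powersetCard 3 : Finset (Finset V)).filter fun s => G.isBad s ∧ P s).card ≤
    ((Finset.univ.powersetCard 3 : Finset (Finset V)).filter fun s => G'.isBad s ∧ P s).card := by
  rw [T3_add_I3, T3_add_I3, ← Finset.card_filter_add_card_filter_not P,
    ← Finset.card_filter_add_card_filter_not (s := Finset.filter G'.isBad _) P] at hmin
  simp only [Finset.filter_filter] at hmin
  have : ((Finset.univ.powersetCard 3 : Finset (Finset V)).filter fun s => G.isBad s ∧ ¬ P s) =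
      (Finset.univ.powersetCard 3 : Finset (Finset V)).filter fun s => G'.isBad s ∧ ¬ P s := by
    apply Finset.filter_congr
    intro s _
    have := h s
    tauto
  rw [this] at hmin
  omega

/-- The vertices forming a bad triple with a given pair. -/
noncomputable def badThird (G : OrientedGraph V) (x y : V) : Finset V :=
  Finset.univ.filter fun w => x ≠ w ∧ y ≠ w ∧ G.isBad {x, y, w}

/-- The ordered pairs forming a bad triple with a given vertex. -/
noncomputable def badLink (G : OrientedGraph V) (u : V) : Finset (V × V) :=
  Finset.univ.filter fun p => u ≠ p.1 ∧ u ≠ p.2 ∧ p.1 ≠ p.2 ∧ G.isBad {u, p.1, p.2}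

theorem card_badThird (G : OrientedGraph V) {x y : V} (hxy : x ≠ y) :
    (G.badThird x y).card = ((Finset.univ.powersetCard 3 : Finset (Finset V)).filter
      fun s => G.isBad s ∧ (x ∈ s ∧ y ∈ s)).card := by
  apply Finset.card_bij (fun w _ => {x, y, w})
  · intro w hw
    simp only [badThird, Finset.mem_filter, Finset.mem_univ, true_and] at hw
    simp only [Finset.mem_filter, Finset.mem_powersetCard, Finset.subset_univ, true_and]
    exact ⟨Finset.card_eq_three.2 ⟨x, y, w, hxy, hw.1, hw.2.1, rfl⟩, hw.2.2, by simp, by simp⟩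
  · intro w hw w' hw' h
    simp only [badThird, Finset.mem_filter, Finset.mem_univ, true_and] at hw hw'
    have : w ∈ ({x, y, w'} : Finset V) := h ▸ by simp
    simp only [Finset.mem_insert, Finset.mem_singleton] at this
    rcases this with h | h | h
    · exact absurd h.symm hw.1
    · exact absurd h.symm hw.2.1
    · exact h
  · intro s hs
    simp only [Finset.mem_filter, Finset.mem_powersetCard, Finset.subset_univ, true_and] at hs
    obtain ⟨h3, hbad, hx, hy⟩ := hs
    have h1 : ((s.erase x).erase y).card = 1 := by
      rw [Finset.card_erase_of_mem (Finset.mem_erase.2 ⟨hxy.symm, hy⟩),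
        Finset.card_erase_of_mem hx, h3]
    obtain ⟨w, hw⟩ := Finset.card_eq_one.1 h1
    have hw' : w ∈ (s.erase x).erase y := hw ▸ by simp
    simp only [Finset.mem_erase] at hw'
    have hs : {x, y, w} = s := by
      rw [← Finset.insert_erase hx, ← Finset.insert_erase (Finset.mem_erase.2 ⟨hxy.symm, hy⟩), hw]
    refine ⟨w, ?_, hs⟩
    simp only [badThird, Finset.mem_filter, Finset.mem_univ, true_and]
    exact ⟨hw'.2.1.symm, hw'.1.symm, hs ▸ hbad⟩

theorem card_badLink (G : OrientedGraph V) (u : V) :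
    (G.badLink u).card = ((Finset.univ.powersetCard 3 : Finset (Finset V)).filter
      fun s => G.isBad s ∧ u ∈ s).card * 2 := by
  rw [Finset.card_eq_sum_card_fiberwise (f := fun p => ({u, p.1, p.2} : Finset V))
    (t := (Finset.univ.powersetCard 3 : Finset (Finset V)).filter
      fun s => G.isBad s ∧ u ∈ s)]
  · apply Finset.sum_const_nat
    intro s hs
    simp only [Finset.mem_filter, Finset.mem_powersetCard, Finset.subset_univ, true_and] at hs
    obtain ⟨h3, hbad, hu⟩ := hs
    have h2 : (s.erase u).card = 2 := by rw [Finset.card_erase_of_mem hu, h3]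
    obtain ⟨a, b, hab, he⟩ := Finset.card_eq_two.1 h2
    have hua : u ≠ a := by
      rintro rfl
      exact Finset.notMem_erase u s (he ▸ by simp)
    have hub : u ≠ b := by
      rintro rfl
      exact Finset.notMem_erase u s (he ▸ by simp)
    have hs : s = {u, a, b} := by rw [← Finset.insert_erase hu, he]
    have hba : ({u, b, a} : Finset V) = {u, a, b} := by rw [Finset.pair_comm]
    rw [Finset.card_eq_two]
    refine ⟨(a, b), (b, a), by simp [hab], ?_⟩
    ext ⟨p, q⟩
    simp only [badLink, Finset.mem_filter, Finset.mem_univ, true_and, Finset.mem_insert,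
      Finset.mem_singleton, Prod.mk.injEq]
    constructor
    · rintro ⟨⟨hp, hq, hpq, -⟩, h⟩
      rw [hs] at h
      have h1 : p ∈ ({u, a, b} : Finset V) := h ▸ by simp
      have h2 : q ∈ ({u, a, b} : Finset V) := h ▸ by simp
      simp only [Finset.mem_insert, Finset.mem_singleton] at h1 h2
      grind
    · rintro (⟨rfl, rfl⟩ | ⟨rfl, rfl⟩)
      · exact ⟨⟨hua, hub, hab, hs ▸ hbad⟩, hs.symm⟩
      · exact ⟨⟨hub, hua, hab.symm, by rw [hba, ← hs]; exact hbad⟩, by rw [hba, ← hs]⟩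
  · rintro ⟨p, q⟩ h
    simp only [badLink, Finset.coe_filter, Finset.mem_univ, true_and, Set.mem_ofPred_eq] at h
    simp only [Finset.coe_filter, Finset.mem_powersetCard, Finset.subset_univ, true_and,
      Set.mem_ofPred_eq]
    exact ⟨Finset.card_eq_three.2 ⟨u, p, q, h.1, h.2.1, h.2.2.1, rfl⟩, h.2.2.2, by simp⟩

theorem card_badThird_le {G G' : OrientedGraph V} (hmin : G.T3 + G.I3 ≤ G'.T3 + G'.I3)
    {x y : V} (hxy : x ≠ y)
    (h : ∀ p q, ¬ (p = x ∧ q = y) → ¬ (p = y ∧ q = x) → (G.adj p q ↔ G'.adj p q)) :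
    (G.badThird x y).card ≤ (G'.badThird x y).card := by
  rw [card_badThird G hxy, card_badThird G' hxy]
  apply card_filter_isBad_le hmin fun s => x ∈ s ∧ y ∈ s
  intro s hs
  refine isBad_congr fun p hp q hq => h p q ?_ ?_
  · rintro ⟨rfl, rfl⟩
    exact hs ⟨hp, hq⟩
  · rintro ⟨rfl, rfl⟩
    exact hs ⟨hq, hp⟩

theorem card_badLink_le {G G' : OrientedGraph V} (hmin : G.T3 + G.I3 ≤ G'.T3 + G'.I3)
    (u : V) (h : ∀ p q, p ≠ u → q ≠ u → (G.adj p q ↔ G'.adj p q)) :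
    (G.badLink u).card ≤ (G'.badLink u).card := by
  rw [card_badLink, card_badLink]
  refine Nat.mul_le_mul_right 2 (card_filter_isBad_le hmin (u ∈ ·) ?_)
  intro s hs
  refine isBad_congr fun p hp q hq => h p q ?_ ?_
  · rintro rfl
    exact hs hp
  · rintro rfl
    exact hs hq

/-- The oriented graph obtained from `G` by replacing the out- and in-neighbourhoods of `u`
by the sets given by `O` and `I`. -/
def redirect (G : OrientedGraph V) (u : V) (O I : V → Prop) (hOI : ∀ v, O v → ¬ I v)
    (hO : ¬ O u) : OrientedGraph V where
  adj p q := (p = u ∧ O q) ∨ (p ≠ u ∧ q = u ∧ I p) ∨ (p ≠ u ∧ q ≠ u ∧ G.adj p q)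
  asymm p q := by
    have := G.asymm p q
    rintro (⟨rfl, h⟩ | ⟨h1, rfl, h⟩ | ⟨h1, h2, h⟩) (⟨h3, h4⟩ | ⟨h3, h4, h5⟩ | ⟨h3, h4, h5⟩) <;>
      simp_all

section redirect

variable {G : OrientedGraph V} {u : V} {O I : V → Prop} {hOI : ∀ v, O v → ¬ I v} {hO : ¬ O u}

theorem redirect_adj_left {q : V} : (G.redirect u O I hOI hO).adj u q ↔ O q := by
  simp [redirect]

theorem redirect_adj_right {p : V} (hp : u ≠ p) :
    (G.redirect u O I hOI hO).adj p u ↔ I p := by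
  simp [redirect, hp.symm]

theorem redirect_adj {p q : V} (hp : u ≠ p) (hq : u ≠ q) :
    (G.redirect u O I hOI hO).adj p q ↔ G.adj p q := by
  simp [redirect, hp.symm, hq.symm]

theorem card_badLink_le_redirect (hmin : ∀ G' : OrientedGraph V, G.T3 + G.I3 ≤ G'.T3 + G'.I3) :
    (G.badLink u).card ≤ ((G.redirect u O I hOI hO).badLink u).card :=
  card_badLink_le (hmin _) u fun _ _ hp hq => (redirect_adj hp.symm hq.symm).symm

theorem card_badThird_le_redirect
    (hmin : ∀ G' : OrientedGraph V, G.T3 + G.I3 ≤ G'.T3 + G'.I3) {y : V} (hy : u ≠ y)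
    (hO' : ∀ v, v ≠ y → (G.adj u v ↔ O v)) (hI' : ∀ v, v ≠ y → (G.adj v u ↔ I v)) :
    (G.badThird u y).card ≤ ((G.redirect u O I hOI hO).badThird u y).card := by
  refine card_badThird_le (hmin _) hy fun p q h1 h2 => ?_
  by_cases hp : p = u
  · subst hp
    rw [redirect_adj_left]
    exact hO' q fun h => h1 ⟨rfl, h⟩
  by_cases hq : q = u
  · subst hq
    rw [redirect_adj_right (Ne.symm hp)]
    exact hI' p fun h => h2 ⟨h, rfl⟩
  rw [redirect_adj (Ne.symm hp) (Ne.symm hq)]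

end redirect

/-- The pairs in the bad link of a vertex that lie in `S × T`. -/
noncomputable def badLinkIn (G : OrientedGraph V) (u : V) (S T : Finset V) : Finset (V × V) :=
  (G.badLink u).filter fun p => p.1 ∈ S ∧ p.2 ∈ T

theorem card_badLinkIn_comm (G : OrientedGraph V) (u : V) (S T : Finset V) :
    (badLinkIn G u S T).card = (badLinkIn G u T S).card := by
  apply Finset.card_equiv (Equiv.prodComm V V)
  rintro ⟨p, q⟩
  simp only [badLinkIn, badLink, Finset.mem_filter, Finset.mem_univ, true_and,
    Equiv.prodComm_apply, Prod.swap_prod_mk, Finset.pair_comm p q]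
  tauto

/-- A partition of the vertices into three parts of size at most `M` and an exceptional set of
size at most `β`, each vertex of a part having at least `m` out-neighbours in the next part and
at least `m` in-neighbours in the previous part. -/
structure IsNearCyclic (G : OrientedGraph V) (P : ZMod 3 → Finset V) (B : Finset V)
    (m M β : ℝ) : Prop where
  disjoint : ∀ i j, i ≠ j → Disjoint (P i) (P j)
  disjoint_exceptional : ∀ i, Disjoint B (P i)
  cover : ∀ v, v ∈ B ∨ ∃ i, v ∈ P i
  card_part_le : ∀ i, ((P i).card : ℝ) ≤ M
  card_exceptional_le : (B.card : ℝ) ≤ β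
  le_outDegIn : ∀ i, ∀ u ∈ P i, m ≤ (G.outDegIn u (P (i + 1)) : ℝ)
  le_inDegIn : ∀ i, ∀ u ∈ P i, m ≤ (G.inDegIn u (P (i - 1)) : ℝ)

theorem card_filter_add_card_filter_le {α : Type} (s : Finset α) (p q : α → Prop) :
    (s.filter p).card + (s.filter q).card ≤ (s.filter fun a => p a ∧ q a).card + s.card := by
  rw [← Finset.card_union_add_card_inter, ← Finset.filter_and, add_comm]
  exact Nat.add_le_add_left (Finset.card_le_card (Finset.union_subset
    (Finset.filter_subset _ _) (Finset.filter_subset _ _))) _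

theorem zmod_three_cases : ∀ i k : ZMod 3, k = i ∨ k = i + 1 ∨ k = i - 1 := by decide

theorem zmod_three_sub_one_sub_one : ∀ i : ZMod 3, i - 1 - 1 = i + 1 := by decide

theorem zmod_three_add_one_ne : ∀ i : ZMod 3, i + 1 ≠ i := by decide

theorem zmod_three_sub_one_ne : ∀ i : ZMod 3, i - 1 ≠ i := by decide

theorem zmod_three_add_one_ne_sub_one : ∀ i : ZMod 3, i + 1 ≠ i - 1 := by decide

namespace IsNearCyclic

variable {G : OrientedGraph V} {P : ZMod 3 → Finset V} {B : Finset V} {m M β : ℝ}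

theorem mem_cases (h : IsNearCyclic G P B m M β) (i : ZMod 3) (v : V) :
    v ∈ B ∨ v ∈ P i ∨ v ∈ P (i + 1) ∨ v ∈ P (i - 1) := by
  rcases h.cover v with hv | ⟨k, hk⟩
  · exact Or.inl hv
  · rcases zmod_three_cases i k with rfl | rfl | rfl <;> tauto

theorem ne_of_mem (h : IsNearCyclic G P B m M β) {i j : ZMod 3} (hij : i ≠ j) {x y : V}
    (hx : x ∈ P i) (hy : y ∈ P j) : x ≠ y :=
  Finset.disjoint_left.1 (h.disjoint i j hij) hx |> fun h' e => h' (e ▸ hy)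

theorem notMem_of_mem (h : IsNearCyclic G P B m M β) {i j : ZMod 3} (hij : i ≠ j) {x : V}
    (hx : x ∈ P i) : x ∉ P j :=
  Finset.disjoint_left.1 (h.disjoint i j hij) hx

theorem card_filter_not_adj_le (h : IsNearCyclic G P B m M β) {i : ZMod 3} {u : V}
    (hu : u ∈ P i) : (((P (i + 1)).filter fun w => ¬ G.adj u w).card : ℝ) ≤ M - m := by
  have h1 := Finset.card_filter_add_card_filter_not (s := P (i + 1)) (fun w => G.adj u w)
  have h2 := h.le_outDegIn i u hu
  have h3 := h.card_part_le (i + 1)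
  unfold outDegIn at h2
  rw [← h1] at h3
  push_cast at h3
  linarith

theorem card_filter_not_adj_le' (h : IsNearCyclic G P B m M β) {i : ZMod 3} {u : V}
    (hu : u ∈ P i) : (((P (i - 1)).filter fun w => ¬ G.adj w u).card : ℝ) ≤ M - m := by
  have h1 := Finset.card_filter_add_card_filter_not (s := P (i - 1)) (fun w => G.adj w u)
  have h2 := h.le_inDegIn i u hu
  have h3 := h.card_part_le (i - 1)
  unfold inDegIn at h2
  rw [← h1] at h3
  push_cast at h3
  linarith

theorem not_adj_same (h : IsNearCyclic G P B m M β)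
    (hmin : ∀ G' : OrientedGraph V, G.T3 + G.I3 ≤ G'.T3 + G'.I3) (hm : 5 * M + β < 6 * m)
    (i : ZMod 3) (x : V) (hx : x ∈ P i) (y : V) (hy : y ∈ P i) : ¬ G.adj x y := by
  intro hadj
  have hasymm := G.asymm
  have hxy : x ≠ y := by
    rintro rfl
    exact G.asymm x x hadj hadj
  have hle := card_badThird_le_redirect (G := G) (u := x) (y := y)
    (O := fun v => G.adj x v ∧ v ≠ y) (I := fun v => G.adj v x)
    (hOI := fun v hv => G.asymm _ _ hv.1) (hO := fun hv => G.asymm _ _ hv.1 hv.1) hmin hxy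
    (by simp +contextual) (by simp)
  set G' := G.redirect x (fun v => G.adj x v ∧ v ≠ y) (fun v => G.adj v x)
    (fun v hv => G.asymm _ _ hv.1) (fun hv => G.asymm _ _ hv.1 hv.1)
  have hlower : ((P (i + 1)).filter fun w => G.adj x w ∧ G.adj y w) ∪
      ((P (i - 1)).filter fun w => G.adj w x ∧ G.adj w y) ⊆ G.badThird x y := by
    intro w hw
    simp only [Finset.mem_union, Finset.mem_filter, badThird, Finset.mem_univ, true_and] at hw ⊢
    rcases hw with ⟨hw, h1, h2⟩ | ⟨hw, h1, h2⟩
    · have hxw := (h.ne_of_mem (zmod_three_add_one_ne i) hw hx).symm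
      have hyw := (h.ne_of_mem (zmod_three_add_one_ne i) hw hy).symm
      exact ⟨hxw, hyw, (isBad_triple G hxy hxw hyw).2 (.inl (.inl ⟨hadj, h2, h1⟩))⟩
    · have hxw := (h.ne_of_mem (zmod_three_sub_one_ne i) hw hx).symm
      have hyw := (h.ne_of_mem (zmod_three_sub_one_ne i) hw hy).symm
      exact ⟨hxw, hyw, (isBad_triple G hxy hxw hyw).2
        (.inl (.inr (.inr (.inr (.inr (.inl ⟨h1, hadj, h2⟩))))))⟩
  have hupper : G'.badThird x y ⊆ (P i ∪ (P (i + 1)).filter fun w => ¬ G.adj x w) ∪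
      (((P (i - 1)).filter fun w => ¬ G.adj w x) ∪ B) := by
    intro w hw
    simp only [Finset.mem_union, Finset.mem_filter, badThird, Finset.mem_univ, true_and] at hw ⊢
    obtain ⟨hxw, hyw, hbad⟩ := hw
    rw [isBad_triple G' hxy hxw hyw, redirect_adj_left, redirect_adj_left, redirect_adj_right hxw,
      redirect_adj_right hxy] at hbad
    have h1 := hasymm x y hadj
    have h2 := hyw.symm
    have h3 : ¬ G.adj x w ∧ ¬ G.adj w x := by grind
    have := h.mem_cases i w
    grind
  have hdisj : Disjoint ((P (i + 1)).filter fun w => G.adj x w ∧ G.adj y w)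
      ((P (i - 1)).filter fun w => G.adj w x ∧ G.adj w y) :=
    Finset.disjoint_filter_filter (h.disjoint _ _ (zmod_three_add_one_ne_sub_one i))
  have c1 := Finset.card_le_card hlower
  rw [Finset.card_union_of_disjoint hdisj] at c1
  have c2 := Finset.card_le_card hupper
  have c3 := Finset.card_union_le (P i ∪ (P (i + 1)).filter fun w => ¬ G.adj x w)
    (((P (i - 1)).filter fun w => ¬ G.adj w x) ∪ B)
  have c4 := Finset.card_union_le (P i) ((P (i + 1)).filter fun w => ¬ G.adj x w)
  have c5 := Finset.card_union_le ((P (i - 1)).filter fun w => ¬ G.adj w x) B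
  have c6 := card_filter_add_card_filter_le (P (i + 1)) (fun w => G.adj x w) (fun w => G.adj y w)
  have c7 := card_filter_add_card_filter_le (P (i - 1)) (fun w => G.adj w x) (fun w => G.adj w y)
  have d1 := h.card_filter_not_adj_le hx
  have d2 := h.card_filter_not_adj_le' hx
  have d3 := h.le_outDegIn i x hx
  have d4 := h.le_outDegIn i y hy
  have d5 := h.le_inDegIn i x hx
  have d6 := h.le_inDegIn i y hy
  have d7 := h.card_part_le i
  have d8 := h.card_part_le (i + 1)
  have d9 := h.card_part_le (i - 1)
  have d10 := h.card_exceptional_le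
  unfold outDegIn at d3 d4
  unfold inDegIn at d5 d6
  rify at hle c1 c2 c3 c4 c5 c6 c7
  linarith

theorem not_adj_prev (h : IsNearCyclic G P B m M β)
    (hmin : ∀ G' : OrientedGraph V, G.T3 + G.I3 ≤ G'.T3 + G'.I3) (hm : 3 * M + β < 4 * m)
    (hindep : ∀ i, ∀ x ∈ P i, ∀ y ∈ P i, ¬ G.adj x y)
    (i : ZMod 3) (x : V) (hx : x ∈ P i) (y : V) (hy : y ∈ P (i - 1)) : ¬ G.adj x y := by
  intro hadj
  have hasymm := G.asymm
  have hxy : x ≠ y := by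
    rintro rfl
    exact G.asymm x x hadj hadj
  have hOI : ∀ v, G.adj x v ∧ v ≠ y → ¬ (G.adj v x ∨ v = y) := by
    rintro v ⟨h1, h2⟩ (h3 | h3)
    · exact G.asymm _ _ h1 h3
    · exact h2 h3
  have hO : ¬ (G.adj x x ∧ x ≠ y) := fun hv => G.asymm _ _ hv.1 hv.1
  have hle := card_badThird_le_redirect (hOI := hOI) (hO := hO) hmin hxy
    (by simp +contextual) (by simp +contextual)
  set G' := G.redirect x (fun v => G.adj x v ∧ v ≠ y) (fun v => G.adj v x ∨ v = y) hOI hO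
  have hlower : ((P (i + 1)).filter fun w => G.adj x w ∧ G.adj w y) ⊆ G.badThird x y := by
    intro w hw
    simp only [Finset.mem_filter, badThird, Finset.mem_univ, true_and] at hw ⊢
    obtain ⟨hw, h1, h2⟩ := hw
    have hxw := (h.ne_of_mem (zmod_three_add_one_ne i) hw hx).symm
    have hyw := (h.ne_of_mem (zmod_three_add_one_ne_sub_one i) hw hy).symm
    exact ⟨hxw, hyw, (isBad_triple G hxy hxw hyw).2 (.inl (.inr (.inl ⟨h1, h2, hadj⟩)))⟩
  have hupper : G'.badThird x y ⊆ (((P (i + 1)).filter fun w => ¬ G.adj x w) ∪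
      ((P (i + 1)).filter fun w => ¬ G.adj w y)) ∪ B := by
    intro w hw
    simp only [Finset.mem_union, Finset.mem_filter, badThird, Finset.mem_univ, true_and] at hw ⊢
    obtain ⟨hxw, hyw, hbad⟩ := hw
    rw [isBad_triple G' hxy hxw hyw, redirect_adj_left, redirect_adj_left, redirect_adj_right hxw,
      redirect_adj_right hxy, redirect_adj hxy hxw, redirect_adj hxw hxy] at hbad
    have h2 := hyw.symm
    rcases h.mem_cases i w with hw | hw | hw | hw
    · grind
    · have h3 := hindep i x hx w hw
      have h4 := hindep i w hw x hx
      grind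
    · have h3 := hasymm x w
      have h4 := hasymm w y
      grind
    · have h3 := hindep _ y hy w hw
      have h4 := hindep _ w hw y hy
      grind
  have c1 := Finset.card_le_card hlower
  have c2 := Finset.card_le_card hupper
  have c3 := Finset.card_union_le (((P (i + 1)).filter fun w => ¬ G.adj x w) ∪
      ((P (i + 1)).filter fun w => ¬ G.adj w y)) B
  have c4 := Finset.card_union_le ((P (i + 1)).filter fun w => ¬ G.adj x w)
    ((P (i + 1)).filter fun w => ¬ G.adj w y)
  have c6 := card_filter_add_card_filter_le (P (i + 1)) (fun w => G.adj x w) (fun w => G.adj w y)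
  have d1 := h.card_filter_not_adj_le hx
  have d2 := h.card_filter_not_adj_le' hy
  have d3 := h.le_outDegIn i x hx
  have d4 := h.le_inDegIn _ y hy
  rw [zmod_three_sub_one_sub_one] at d2 d4
  have d8 := h.card_part_le (i + 1)
  have d10 := h.card_exceptional_le
  unfold outDegIn at d3
  unfold inDegIn at d4
  rify at hle c1 c2 c3 c4 c6
  linarith

theorem card_nonadj_le (h : IsNearCyclic G P B m M β)
    (hmin : ∀ G' : OrientedGraph V, G.T3 + G.I3 ≤ G'.T3 + G'.I3)
    (hindep : ∀ i, ∀ x ∈ P i, ∀ y ∈ P i, ¬ G.adj x y)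
    (hprev : ∀ i, ∀ x ∈ P i, ∀ y ∈ P (i - 1), ¬ G.adj x y)
    (i : ZMod 3) (y : V) (hy : y ∈ P (i + 1)) :
    ((P i).filter fun w => ¬ G.adj w y).card ≤ 2 * B.card + 1 := by
  have hback : ∀ w ∈ P i, ¬ G.adj y w := fun w hw =>
    hprev (i + 1) y hy w (by rwa [add_sub_cancel_right])
  have hyP : y ∉ P i := h.notMem_of_mem (zmod_three_add_one_ne i) hy
  have hOI : ∀ v, G.adj y v → ¬ (G.adj v y ∨ v ∈ P i) := by
    rintro v h1 (h2 | h2)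
    · exact G.asymm _ _ h1 h2
    · exact hback v h2 h1
  have hle := card_badLink_le_redirect (hOI := hOI)
    (hO := fun hv : G.adj y y => G.asymm _ _ hv hv) hmin
  set G' := G.redirect y (fun v => G.adj y v) (fun v => G.adj v y ∨ v ∈ P i) hOI
    (fun hv => G.asymm _ _ hv hv)
  set K := (P i).filter fun w => ¬ G.adj w y
  have hmemK : ∀ v, v ∈ K ↔ v ∈ P i ∧ ¬ G.adj v y := fun v => Finset.mem_filter
  have hgood : ∀ p q, y ≠ p → y ≠ q → p ≠ q → p ∈ K → q ∉ B → ¬ G'.isBad {y, p, q} := by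
    intro p q hp hq hpq hpK hqB hbad
    rw [hmemK] at hpK
    have h1 := hback p hpK.1
    rw [isBad_triple G' hp hq hpq, redirect_adj_left, redirect_adj_left, redirect_adj_right hp,
      redirect_adj_right hq, redirect_adj hp hq, redirect_adj hq hp] at hbad
    rcases h.mem_cases i q with hq | hq | hq | hq
    · exact hqB hq
    · have h2 := hindep i p hpK.1 q hq
      have h3 := hindep i q hq p hpK.1
      grind
    · have h2 := hindep _ y hy q hq
      have h3 := hindep _ q hq y hy
      have h4 := h.notMem_of_mem (zmod_three_add_one_ne i) hq
      grind
    · have h2 := hprev _ p hpK.1 q hq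
      have h3 := hprev _ q hq y (by rwa [zmod_three_sub_one_sub_one])
      have h4 := h.notMem_of_mem (zmod_three_sub_one_ne i) hq
      grind
  have hKL : K.offDiag ⊆ G.badLink y := by
    rintro ⟨p, q⟩ hpq
    simp only [Finset.mem_offDiag, hmemK] at hpq
    obtain ⟨⟨hp, hp'⟩, ⟨hq, hq'⟩, hpq⟩ := hpq
    have hyp : y ≠ p := fun e => hyP (e ▸ hp)
    have hyq : y ≠ q := fun e => hyP (e ▸ hq)
    simp only [badLink, Finset.mem_filter, Finset.mem_univ, true_and]
    refine ⟨hyp, hyq, hpq, (isBad_triple G hyp hyq hpq).2 (.inr ?_)⟩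
    exact ⟨hback p hp, hp', hback q hq, hq', hindep i p hp q hq, hindep i q hq p hp⟩
  have hL : G'.badLink y ⊆ (G.badLink y \ K.offDiag) ∪ (K ×ˢ B ∪ B ×ˢ K) := by
    rintro ⟨p, q⟩ hpq
    simp only [badLink, Finset.mem_filter, Finset.mem_univ, true_and, Finset.mem_union,
      Finset.mem_sdiff, Finset.mem_product, Finset.mem_offDiag] at hpq ⊢
    obtain ⟨hp, hq, hpq, hbad⟩ := hpq
    by_cases hpK : p ∈ K
    · by_cases hqB : q ∈ B
      · exact .inr (.inl ⟨hpK, hqB⟩)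
      · exact absurd hbad (hgood p q hp hq hpq hpK hqB)
    by_cases hqK : q ∈ K
    · by_cases hpB : p ∈ B
      · exact .inr (.inr ⟨hpB, hqK⟩)
      · rw [Finset.pair_comm] at hbad
        exact absurd hbad (hgood q p hq hp hpq.symm hqK hpB)
    refine .inl ⟨⟨hp, hq, hpq, ?_⟩, fun h => hpK h.1⟩
    rw [isBad_triple G' hp hq hpq, redirect_adj_left, redirect_adj_left, redirect_adj_right hp,
      redirect_adj_right hq, redirect_adj hp hq, redirect_adj hq hp] at hbad
    rw [isBad_triple G hp hq hpq]
    have h1 : (G.adj p y ∨ p ∈ P i) ↔ G.adj p y := by grind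
    have h2 : (G.adj q y ∨ q ∈ P i) ↔ G.adj q y := by grind
    rwa [h1, h2] at hbad
  have c1 := Finset.card_le_card hL
  have c2 := Finset.card_union_le (G.badLink y \ K.offDiag) (K ×ˢ B ∪ B ×ˢ K)
  have c3 := Finset.card_union_le (K ×ˢ B) (B ×ˢ K)
  have c4 := Finset.card_sdiff_add_card_eq_card hKL
  rw [Finset.card_product, Finset.card_product] at c3
  rw [Finset.offDiag_card] at c4
  have c5 : K.card * K.card ≤ K.card * (2 * B.card + 1) := by
    have : K.card ≤ K.card * K.card := Nat.le_mul_self _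
    have : K.card * (2 * B.card + 1) = K.card * B.card + B.card * K.card + K.card := by ring
    omega
  rcases Nat.eq_zero_or_pos K.card with h0 | h0
  · omega
  · exact Nat.le_of_mul_le_mul_left c5 h0

theorem card_nonadj_pairs_le (h : IsNearCyclic G P B m M β)
    (hmin : ∀ G' : OrientedGraph V, G.T3 + G.I3 ≤ G'.T3 + G'.I3)
    (hindep : ∀ i, ∀ x ∈ P i, ∀ y ∈ P i, ¬ G.adj x y)
    (hprev : ∀ i, ∀ x ∈ P i, ∀ y ∈ P (i - 1), ¬ G.adj x y) (i : ZMod 3) :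
    ((P i ×ˢ P (i + 1)).filter fun p => ¬ G.adj p.1 p.2).card ≤
      (P (i + 1)).card * (2 * B.card + 1) := by
  have hsub : ((P i ×ˢ P (i + 1)).filter fun p => ¬ G.adj p.1 p.2) ⊆
      (P (i + 1)).biUnion fun y => ((P i).filter fun w => ¬ G.adj w y) ×ˢ {y} := by
    rintro ⟨p, q⟩ hpq
    simp only [Finset.mem_filter, Finset.mem_product] at hpq
    simp only [Finset.mem_biUnion, Finset.mem_product, Finset.mem_filter, Finset.mem_singleton]
    exact ⟨q, hpq.1.2, ⟨hpq.1.1, hpq.2⟩, rfl⟩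
  refine (Finset.card_le_card hsub).trans (Finset.card_biUnion_le_card_mul _ _ _ fun y hy => ?_)
  rw [Finset.card_product, Finset.card_singleton, mul_one]
  exact h.card_nonadj_le hmin hindep hprev i y hy

/-- Upper bound obtained by turning an exceptional vertex into a vertex of the part `P i`. -/
theorem card_badLink_le_of_mem (h : IsNearCyclic G P B m M β)
    (hmin : ∀ G' : OrientedGraph V, G.T3 + G.I3 ≤ G'.T3 + G'.I3)
    (hindep : ∀ i, ∀ x ∈ P i, ∀ y ∈ P i, ¬ G.adj x y)
    (hprev : ∀ i, ∀ x ∈ P i, ∀ y ∈ P (i - 1), ¬ G.adj x y) (i : ZMod 3) (u : V) (hu : u ∈ B) :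
    (G.badLink u).card ≤
      (P i).card * (P i).card + 2 * (B.card * Fintype.card V) := by
  have hOI : ∀ v, v ∈ P (i + 1) → ¬ v ∈ P (i - 1) := fun v hv =>
    h.notMem_of_mem (zmod_three_add_one_ne_sub_one i) hv
  have hO : u ∉ P (i + 1) := Finset.disjoint_left.1 (h.disjoint_exceptional _) hu
  have hle := card_badLink_le_redirect (hOI := hOI) (hO := hO) hmin
  set G' := G.redirect u (fun v => v ∈ P (i + 1)) (fun v => v ∈ P (i - 1)) hOI hO
  have hgood : ∀ p q, u ≠ p → u ≠ q → p ≠ q → p ∉ P i → p ∉ B → q ∉ B →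
      ¬ G'.isBad {u, p, q} := by
    intro p q hp hq hpq hpi hpB hqB hbad
    rw [isBad_triple G' hp hq hpq, redirect_adj_left, redirect_adj_left, redirect_adj_right hp,
      redirect_adj_right hq, redirect_adj hp hq, redirect_adj hq hp] at hbad
    have hpO := hOI p
    have hqO := hOI q
    have h1 := hindep (i + 1) p
    have h2 := hindep (i - 1) p
    have h3 := hprev (i - 1) p
    have h4 := hprev (i - 1) q
    rw [zmod_three_sub_one_sub_one] at h3 h4
    have h5 := hindep (i + 1) q
    have h6 := hindep (i - 1) q
    have hqi : q ∈ P i → q ∉ P (i + 1) ∧ q ∉ P (i - 1) := fun hq =>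
      ⟨h.notMem_of_mem (zmod_three_add_one_ne i).symm hq,
        h.notMem_of_mem (zmod_three_sub_one_ne i).symm hq⟩
    rcases h.mem_cases i p with hp | hp | hp | hp <;>
      rcases h.mem_cases i q with hq | hq | hq | hq <;> grind
  have hL : G'.badLink u ⊆ P i ×ˢ P i ∪ (B ×ˢ Finset.univ ∪ Finset.univ ×ˢ B) := by
    rintro ⟨p, q⟩ hpq
    simp only [badLink, Finset.mem_filter, Finset.mem_univ, true_and, Finset.mem_union,
      Finset.mem_product, and_true] at hpq ⊢
    obtain ⟨hp, hq, hpq, hbad⟩ := hpq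
    have h1 := hgood p q hp hq hpq
    have h2 := hgood q p hq hp hpq.symm
    rw [Finset.pair_comm] at h2
    tauto
  have c1 := Finset.card_le_card hL
  have c2 := Finset.card_union_le (P i ×ˢ P i)
    ((B ×ˢ Finset.univ : Finset (V × V)) ∪ Finset.univ ×ˢ B)
  have c3 := Finset.card_union_le (B ×ˢ Finset.univ : Finset (V × V)) (Finset.univ ×ˢ B)
  simp only [Finset.card_product, Finset.card_univ] at c2 c3
  rw [mul_comm (Fintype.card V)] at c3
  omega

theorem sum_card_badLinkIn_le (h : IsNearCyclic G P B m M β) (u : V) :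
    ∑ j, ((badLinkIn G u (P j) (P j)).card + 2 * (badLinkIn G u (P j) (P (j + 1))).card) ≤
      (G.badLink u).card := by
  have h1 : ∑ jk : ZMod 3 × ZMod 3, (badLinkIn G u (P jk.1) (P jk.2)).card ≤
      (G.badLink u).card := by
    rw [← Finset.card_biUnion]
    · exact Finset.card_le_card (Finset.biUnion_subset.2 fun _ _ => Finset.filter_subset _ _)
    · rintro ⟨j, k⟩ - ⟨j', k'⟩ - hne
      rw [Function.onFun, Finset.disjoint_left]
      rintro ⟨p, q⟩ hpq hpq'
      simp only [badLinkIn, Finset.mem_filter] at hpq hpq'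
      by_cases hj : j = j'
      · exact h.ne_of_mem (fun hk => hne (by rw [hj, hk])) hpq.2.2 hpq'.2.2 rfl
      · exact h.ne_of_mem hj hpq.2.1 hpq'.2.1 rfl
  have h2 : ∑ jk : ZMod 3 × ZMod 3, (badLinkIn G u (P jk.1) (P jk.2)).card =
      ∑ j, ∑ d, (badLinkIn G u (P j) (P (j + d))).card := by
    rw [Fintype.sum_prod_type]
    exact Finset.sum_congr rfl fun j _ => (Equiv.sum_comp (Equiv.addLeft j) _).symm
  have h3 : ∑ j, (badLinkIn G u (P j) (P (j + 2))).card =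
      ∑ j, (badLinkIn G u (P j) (P (j + 1))).card := by
    rw [← Equiv.sum_comp (Equiv.addRight (1 : ZMod 3))]
    refine Finset.sum_congr rfl fun j _ => ?_
    rw [card_badLinkIn_comm, Equiv.coe_addRight]
    congr 3
    revert j
    decide
  have huniv : (Finset.univ : Finset (ZMod 3)) = {0, 1, 2} := by decide
  have h4 : ∀ f : ZMod 3 → ℕ, ∑ d, f d = f 0 + f 1 + f 2 := by
    intro f
    rw [huniv, Finset.sum_insert (by decide), Finset.sum_pair (by decide), add_assoc]
  rw [h2] at h1
  simp only [h4 (fun d => (badLinkIn G u (P _) (P (_ + d))).card), add_zero,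
    Finset.sum_add_distrib] at h1
  rw [Finset.sum_add_distrib, ← Finset.mul_sum]
  rw [h3] at h1
  omega

theorem card_nonneighbours_add (G : OrientedGraph V) (u : V) (S : Finset V) :
    (S.filter fun w => ¬ G.adj u w ∧ ¬ G.adj w u).card + G.outDegIn u S + G.inDegIn u S =
      S.card := by
  have h1 := Finset.card_filter_add_card_filter_not (s := S) (fun w => G.adj u w)
  have h2 := Finset.card_filter_add_card_filter_not (s := S.filter fun w => ¬ G.adj u w)
    (fun w => G.adj w u)
  rw [Finset.filter_filter, Finset.filter_filter] at h2
  have h3 : (S.filter fun w => ¬ G.adj u w ∧ G.adj w u) = S.filter fun w => G.adj w u :=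
    Finset.filter_congr fun w _ => and_iff_right_of_imp (G.asymm w u)
  rw [h3] at h2
  unfold outDegIn inDegIn
  omega

theorem sq_card_nonneighbours_le (h : IsNearCyclic G P B m M β)
    (hindep : ∀ i, ∀ x ∈ P i, ∀ y ∈ P i, ¬ G.adj x y) (i : ZMod 3) (u : V) (hu : u ∈ B) :
    ((P i).filter fun w => ¬ G.adj u w ∧ ¬ G.adj w u).card ^ 2 ≤
      (badLinkIn G u (P i) (P i)).card + (P i).card := by
  set C := (P i).filter fun w => ¬ G.adj u w ∧ ¬ G.adj w u
  have hmem : ∀ v, v ∈ C ↔ v ∈ P i ∧ ¬ G.adj u v ∧ ¬ G.adj v u := fun v => Finset.mem_filter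
  have huP : u ∉ P i := Finset.disjoint_left.1 (h.disjoint_exceptional _) hu
  have hsub : C.offDiag ⊆ badLinkIn G u (P i) (P i) := by
    rintro ⟨p, q⟩ hpq
    simp only [Finset.mem_offDiag, hmem] at hpq
    obtain ⟨⟨hp, hp'⟩, ⟨hq, hq'⟩, hpq⟩ := hpq
    have hup : u ≠ p := fun e => huP (e ▸ hp)
    have huq : u ≠ q := fun e => huP (e ▸ hq)
    simp only [badLinkIn, badLink, Finset.mem_filter, Finset.mem_univ, true_and]
    refine ⟨⟨hup, huq, hpq, (isBad_triple G hup huq hpq).2 (.inr ?_)⟩, hp, hq⟩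
    exact ⟨hp'.1, hp'.2, hq'.1, hq'.2, hindep i p hp q hq, hindep i q hq p hp⟩
  have c1 := Finset.card_le_card hsub
  have c2 : C.card ≤ (P i).card := Finset.card_filter_le _ _
  rw [Finset.offDiag_card] at c1
  rw [sq]
  omega

theorem transitive_products_le (h : IsNearCyclic G P B m M β) (i : ZMod 3) (u : V) (hu : u ∈ B) :
    G.outDegIn u (P i) * G.outDegIn u (P (i + 1)) + G.inDegIn u (P i) * G.inDegIn u (P (i + 1)) +
      G.inDegIn u (P i) * G.outDegIn u (P (i + 1)) ≤
    (badLinkIn G u (P i) (P (i + 1))).card +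
      ((P i ×ˢ P (i + 1)).filter fun p => ¬ G.adj p.1 p.2).card := by
  have hasymm := G.asymm
  have huP : ∀ j, u ∉ P j := fun j => Finset.disjoint_left.1 (h.disjoint_exceptional _) hu
  simp only [outDegIn, inDegIn, ← Finset.card_product]
  rw [← Finset.card_union_of_disjoint, ← Finset.card_union_of_disjoint]
  · refine (Finset.card_le_card ?_).trans (Finset.card_union_le _ _)
    rintro ⟨p, q⟩ hpq
    simp only [Finset.mem_union, Finset.mem_product, Finset.mem_filter, badLinkIn, badLink,
      Finset.mem_univ, true_and] at hpq ⊢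
    have hp : p ∈ P i := by tauto
    have hq : q ∈ P (i + 1) := by tauto
    have hup : u ≠ p := fun e => huP _ (e ▸ hp)
    have huq : u ≠ q := fun e => huP _ (e ▸ hq)
    have hne : p ≠ q := h.ne_of_mem (zmod_three_add_one_ne i).symm hp hq
    rw [isBad_triple G hup huq hne]
    by_cases hadj : G.adj p q
    · left
      refine ⟨⟨hup, huq, hne, .inl ?_⟩, hp, hq⟩
      rcases hpq with (⟨h1, h2⟩ | ⟨h1, h2⟩) | ⟨h1, h2⟩
      · exact .inl ⟨h1.2, hadj, h2.2⟩
      · exact .inr (.inr (.inr (.inl ⟨hadj, h2.2, h1.2⟩)))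
      · exact .inr (.inr (.inl ⟨h1.2, h2.2, hadj⟩))
    · exact .inr ⟨⟨hp, hq⟩, hadj⟩
  · rw [Finset.disjoint_left]
    rintro ⟨p, q⟩
    simp only [Finset.mem_union, Finset.mem_product, Finset.mem_filter]
    rintro (⟨h1, h1'⟩ | ⟨h1, h1'⟩) ⟨h2, h2'⟩
    · exact hasymm _ _ h1.2 h2.2
    · exact hasymm _ _ h1'.2 h2'.2
  · rw [Finset.disjoint_left]
    rintro ⟨p, q⟩
    simp only [Finset.mem_product, Finset.mem_filter]
    rintro ⟨h1, -⟩ ⟨h2, -⟩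
    exact hasymm _ _ h1.2 h2.2

theorem sum_sq_add_products_le (h : IsNearCyclic G P B m M β)
    (hmin : ∀ G' : OrientedGraph V, G.T3 + G.I3 ≤ G'.T3 + G'.I3)
    (hindep : ∀ i, ∀ x ∈ P i, ∀ y ∈ P i, ¬ G.adj x y)
    (hprev : ∀ i, ∀ x ∈ P i, ∀ y ∈ P (i - 1), ¬ G.adj x y) (u : V) (hu : u ∈ B) :
    ∑ j, (((P j).filter fun w => ¬ G.adj u w ∧ ¬ G.adj w u).card ^ 2 +
      2 * (G.outDegIn u (P j) * G.outDegIn u (P (j + 1)) +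
        G.inDegIn u (P j) * G.inDegIn u (P (j + 1)) +
        G.inDegIn u (P j) * G.outDegIn u (P (j + 1)))) ≤
    (P 0).card ^ 2 + 6 * (B.card * Fintype.card V) + 3 * Fintype.card V := by
  have hcard : ∑ j, (P j).card ≤ Fintype.card V := by
    rw [← Finset.card_biUnion fun i _ j _ hij => h.disjoint i j hij]
    exact Finset.card_le_univ _
  have hshift : ∑ j, (P (j + 1)).card = ∑ j, (P j).card :=
    Equiv.sum_comp (Equiv.addRight (1 : ZMod 3)) fun j => (P j).card
  have h1 := (h.sum_card_badLinkIn_le u).trans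
    (h.card_badLink_le_of_mem hmin hindep hprev 0 u hu)
  have h2 : ∀ j, ((P j).filter fun w => ¬ G.adj u w ∧ ¬ G.adj w u).card ^ 2 +
      2 * (G.outDegIn u (P j) * G.outDegIn u (P (j + 1)) +
        G.inDegIn u (P j) * G.inDegIn u (P (j + 1)) +
        G.inDegIn u (P j) * G.outDegIn u (P (j + 1))) ≤
      ((badLinkIn G u (P j) (P j)).card + 2 * (badLinkIn G u (P j) (P (j + 1))).card) +
      ((P j).card + (P (j + 1)).card * (2 * (2 * B.card + 1))) := by
    intro j
    have a1 := h.sq_card_nonneighbours_le hindep j u hu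
    have a2 := h.transitive_products_le j u hu
    have a3 := h.card_nonadj_pairs_le hmin hindep hprev j
    linarith
  refine (Finset.sum_le_sum fun j _ => h2 j).trans ?_
  rw [Finset.sum_add_distrib, Finset.sum_add_distrib (f := fun j => (P j).card),
    ← Finset.sum_mul, hshift]
  have h3 := Nat.mul_le_mul_right (2 * (2 * B.card + 1)) hcard
  rw [← sq] at h1
  linarith

/-- In a minimizer, every exceptional vertex is attached to the parts almost like the vertices
of some part. -/
theorem exists_typical_degrees (h : IsNearCyclic G P B m M β)
    (hmin : ∀ G' : OrientedGraph V, G.T3 + G.I3 ≤ G'.T3 + G'.I3)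
    (hindep : ∀ i, ∀ x ∈ P i, ∀ y ∈ P i, ¬ G.adj x y)
    (hprev : ∀ i, ∀ x ∈ P i, ∀ y ∈ P (i - 1), ¬ G.adj x y) {N ε δ : ℝ}
    (hN : (Fintype.card V : ℝ) = N) (hε : 0 < ε) (hNε : 3 ≤ ε * N) (hδ : 0 ≤ δ)
    (hδ' : δ ≤ 1 / 10 ^ 6) (hεδ : 240000 * ε ≤ δ ^ 2)
    (hlower : ∀ i, (1 / 3 - 20 * ε) * N ≤ ((P i).card : ℝ))
    (hupper : ∀ i, ((P i).card : ℝ) ≤ (1 / 3 + 48 * ε) * N)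
    (hB : (B.card : ℝ) ≤ 48 * ε * N) (u : V) (hu : u ∈ B) :
    ∃ i, (1 / 3 - δ) * N ≤ (G.outDegIn u (P (i + 1)) : ℝ) ∧
      (1 / 3 - δ) * N ≤ (G.inDegIn u (P (i - 1)) : ℝ) := by
  have hN0 : 0 < N := pos_of_mul_pos_right (by linarith) hε.le
  have hε1 : ε ≤ 1 / 10000 := by nlinarith
  set r : ℝ := 3 / N
  have hr0 : 0 < r := by positivity
  have hrN : r * N = 3 := div_mul_cancel₀ 3 hN0.ne'
  have hrε : r ≤ ε := (div_le_iff₀ hN0).2 hNε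
  set c : ZMod 3 → ℝ := fun j =>
    (((P j).filter fun w => ¬ G.adj u w ∧ ¬ G.adj w u).card : ℝ) with hc
  set a : ZMod 3 → ℝ := fun j => r * (G.outDegIn u (P j) : ℝ) with ha
  set b : ZMod 3 → ℝ := fun j => r * (G.inDegIn u (P j) : ℝ) with hb
  have ha0 : ∀ j, 0 ≤ a j := fun j => by positivity
  have hb0 : ∀ j, 0 ≤ b j := fun j => by positivity
  have hc0 : ∀ j, 0 ≤ r * c j := fun j => by positivity
  have hsum : ∀ j, r * c j + a j + b j = r * (P j).card := by
    intro j
    rw [← card_nonneighbours_add G u (P j)]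
    push_cast
    ring
  have hv1 : ∀ j, r * (P j).card ≤ 1 + 144 * ε := fun j => by
    have := mul_le_mul_of_nonneg_left (hupper j) hr0.le
    linear_combination this + (1 / 3 + 48 * ε) * hrN
  have hv0 : ∀ j, 1 - 60 * ε ≤ r * (P j).card := fun j => by
    have := mul_le_mul_of_nonneg_left (hlower j) hr0.le
    linear_combination this - (1 / 3 - 20 * ε) * hrN
  have hcount := h.sum_sq_add_products_le hmin hindep hprev u hu
  rify at hcount
  rw [hN] at hcount
  have hscaled : ∑ j, ((r * c j) ^ 2 + 2 * (a j * a (j + 1) + b j * b (j + 1) +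
      b j * a (j + 1))) ≤ 1 + 2901 * ε := by
    have h1 := mul_le_mul_of_nonneg_left hcount (sq_nonneg r)
    rw [Finset.mul_sum] at h1
    have h2 : (r * (P 0).card) ^ 2 ≤ (1 + 144 * ε) ^ 2 :=
      pow_le_pow_left₀ (by positivity) (hv1 0) 2
    have h3 : r ^ 2 * (6 * (B.card * N)) ≤ 2592 * ε := by
      have := mul_le_mul_of_nonneg_left hB (by positivity : 0 ≤ r ^ 2 * (6 * N))
      calc r ^ 2 * (6 * (B.card * N)) = r ^ 2 * (6 * N) * B.card := by ring
        _ ≤ _ := this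
        _ = 288 * ε * (r * N) ^ 2 := by ring
        _ = 2592 * ε := by rw [hrN]; ring
    have h4 : r ^ 2 * (3 * N) = 9 * r := by
      linear_combination 3 * r * hrN
    have h5 : (1 + 144 * ε) ^ 2 ≤ 1 + 300 * ε := by nlinarith
    calc _ = _ := Finset.sum_congr rfl fun j _ => by simp only [ha, hb, hc]; ring
      _ ≤ _ := h1
      _ ≤ 1 + 2901 * ε := by linarith
  have hF : ∑ j, ((1 - a j - b j) ^ 2 / 2 +
      (a j * a (j + 1) + b j * b (j + 1) + b j * a (j + 1))) ≤ 1 / 2 + 2400 * ε := by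
    have h1 : ∀ j, (1 - a j - b j) ^ 2 / 2 +
        (a j * a (j + 1) + b j * b (j + 1) + b j * a (j + 1)) ≤
        ((r * c j) ^ 2 + 2 * (a j * a (j + 1) + b j * b (j + 1) + b j * a (j + 1))) / 2 +
          300 * ε := by
      intro j
      obtain ⟨e, he⟩ : ∃ e, e = 1 - r * (P j).card := ⟨_, rfl⟩
      have he1 : e ≤ 60 * ε := by linarith [hv0 j]
      have he2 : -(144 * ε) ≤ e := by linarith [hv1 j]
      have hc2 : r * c j ≤ 2 := by linarith [hsum j, ha0 j, hb0 j, hv1 j]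
      have h2 : 1 - a j - b j = r * c j + e := by linarith [hsum j]
      have h3 : r * c j * e ≤ 2 * (60 * ε) := by
        nlinarith [mul_le_mul_of_nonneg_left he1 (hc0 j)]
      have h4 : e ^ 2 ≤ (144 * ε) ^ 2 := sq_le_sq' he2 (by linarith)
      have h5 : (144 * ε) ^ 2 ≤ 3 * ε := by nlinarith
      rw [h2]
      linarith [add_sq (r * c j) e]
    refine (Finset.sum_le_sum fun j _ => h1 j).trans ?_
    rw [Finset.sum_add_distrib, ← Finset.sum_div, Finset.sum_const, Finset.card_univ, ZMod.card,
      nsmul_eq_mul]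
    push_cast
    linarith
  obtain ⟨i, hi1, hi2⟩ := cyclic_weights_stability ha0 hb0
    (fun j => by linarith [hsum j, hc0 j, hv1 j]) hδ (by linarith) (by linarith) hF
  have key : ∀ d : ℝ, 1 - 2 * δ ≤ r * d → (1 / 3 - δ) * N ≤ d := by
    intro d hd
    have h1 := mul_le_mul_of_nonneg_left hd hN0.le
    have h2 : N * (r * d) = 3 * d := by linear_combination d * hrN
    linarith [mul_nonneg hN0.le hδ]
  exact ⟨i, key _ hi1, key _ hi2⟩

end IsNearCyclic

end OrientedGraph


/-- There is ε₀ > 0 such that for all 0 < ε < ε₀ there is n₀ such that for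
every n ≥ n₀: if `G` is an oriented graph on n vertices minimizing
`T₃ + I₃`, and `V = V₀ ⊔ V₁ ⊔ V₂ ⊔ B` is a partition satisfying conditions
(1)–(4), then each `V_i` is independent, there are no edges from `V_i` to
`V_{i−1}`, and `B = ∅` (indices mod 3). -/
theorem stmt_17 :
    ∃ ε₀ : ℝ, 0 < ε₀ ∧ ∀ ε : ℝ, 0 < ε → ε < ε₀ →
      ∃ n₀ : ℕ, 0 < n₀ ∧ ∀ n : ℕ, n₀ ≤ n →
        ∀ G : OrientedGraph (Fin n),
          (∀ G' : OrientedGraph (Fin n), G.T3 + G.I3 ≤ G'.T3 + G'.I3) →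
          ∀ (Vf : ZMod 3 → Finset (Fin n)) (B : Finset (Fin n)),
            (∀ i j : ZMod 3, i ≠ j → Disjoint (Vf i) (Vf j)) →
            (∀ i : ZMod 3, Disjoint B (Vf i)) →
            (∀ v : Fin n, v ∈ B ∨ ∃ i : ZMod 3, v ∈ Vf i) →
            -- (1)
            (∀ i : ZMod 3,
              (1 / 3 - 20 * ε) * (n : ℝ) ≤ ((Vf i).card : ℝ) ∧
              ((Vf i).card : ℝ) ≤ (1 / 3 + 48 * ε) * (n : ℝ)) →
            -- (2)
            (∀ i : ZMod 3, ∀ u ∈ Vf i,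
              (1 / 3 - ε ^ ((1 : ℝ) / 3)) * (n : ℝ) ≤ (G.outDegIn u (Vf (i + 1)) : ℝ) ∧
              (1 / 3 - ε ^ ((1 : ℝ) / 3)) * (n : ℝ) ≤ (G.inDegIn u (Vf (i - 1)) : ℝ)) →
            -- (3)
            ((B.card : ℝ) ≤ 48 * ε * (n : ℝ)) →
            -- (4)
            (∀ u ∈ B, ∀ i : ZMod 3,
              (G.outDegIn u (Vf (i + 1)) : ℝ) < (1 / 3 - ε ^ ((1 : ℝ) / 3)) * (n : ℝ) ∨
              (G.inDegIn u (Vf (i - 1)) : ℝ) < (1 / 3 - ε ^ ((1 : ℝ) / 3)) * (n : ℝ)) →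
            -- conclusions (a), (b), (c)
            ((∀ i : ZMod 3, ∀ x ∈ Vf i, ∀ y ∈ Vf i, ¬ G.adj x y) ∧
              (∀ i : ZMod 3, ∀ x ∈ Vf i, ∀ y ∈ Vf (i - 1), ¬ G.adj x y) ∧
              B = ∅) := by
  refine ⟨1 / 10 ^ 18, by norm_num, fun ε hε hε₀ => ?_⟩
  obtain ⟨δ, hδ⟩ : ∃ δ, δ = ε ^ ((1 : ℝ) / 3) := ⟨_, rfl⟩
  have hδ0 : 0 < δ := hδ ▸ Real.rpow_pos_of_pos hε _
  have hδ3 : δ ^ 3 = ε := by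
    rw [hδ, ← Real.rpow_natCast, ← Real.rpow_mul hε.le]
    norm_num
  have hδ1 : δ < 1 / 10 ^ 6 := by
    refine lt_of_pow_lt_pow_left₀ 3 (by norm_num) ?_
    rw [hδ3]
    exact hε₀.trans_eq (by norm_num)
  have hεδ : 240000 * ε ≤ δ ^ 2 := by
    rw [← hδ3]
    nlinarith [mul_le_mul_of_nonneg_left hδ1.le (sq_nonneg δ)]
  rw [← hδ]
  refine ⟨⌈3 / ε⌉₊ + 1, Nat.succ_pos _, ?_⟩
  intro n hn G hmin P B hdisj hdisjB hcover hsize hdeg hB hB'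
  have hn' : 3 / ε ≤ n := (Nat.le_ceil _).trans (by exact_mod_cast (Nat.le_succ _).trans hn)
  have hNε : 3 ≤ ε * n := by
    rw [div_le_iff₀ hε] at hn'
    linarith
  have hn0 : (0 : ℝ) < n := pos_of_mul_pos_right (by linarith) hε.le
  have h : G.IsNearCyclic P B ((1 / 3 - δ) * n) ((1 / 3 + 48 * ε) * n) (48 * ε * n) :=
    ⟨hdisj, hdisjB, hcover, fun i => (hsize i).2, hB, fun i u hu => (hdeg i u hu).1,
      fun i u hu => (hdeg i u hu).2⟩
  have hindep := h.not_adj_same hmin (by nlinarith)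
  have hprev := h.not_adj_prev hmin (by nlinarith) hindep
  refine ⟨hindep, hprev, Finset.eq_empty_of_forall_notMem fun u hu => ?_⟩
  obtain ⟨i, hi1, hi2⟩ := h.exists_typical_degrees hmin hindep hprev
    (by rw [Fintype.card_fin]) hε hNε hδ0.le hδ1.le hεδ (fun i => (hsize i).1)
    (fun i => (hsize i).2) hB u hu
  rcases hB' u hu i with h1 | h1 <;> linarith
end
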